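/- arXiv:2302.09811 — 5 statements merged into one kernel-verified Lean document; each statement's English description precedes it below -/
import Mathlib

section
/- Let H = A∗_C be the HNN extension associated to injections i_P, i_N : C → A with images C_P, C_N, and for k ≥ 0 let A_k ≤ H be the subgroup generated by {t^{−i} a t^{i} : a ∈ A, 0 ≤ i ≤ k}, with the convention A_{−1} = C_N. Suppose for some 2 ≤ n ≤ ∞ both pairs (A, C_P) and (A, C_N) are n-RF. Then for every k ≥ 1 the pairs (A_{k−1}, t^{−1}A_{k−2}t) and (A_{k−1}, A_{k−2}) are n-RF (as group–subgroup pairs inside H). -/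
/-- An element `a ∈ A \ C` is *length-`n` relatively free* (`n`-RF) relative to the subgroup `C`
if every product `a^{e 0} * c 0 * a^{e 1} * c 1 * ⋯` of length `k ≥ 1` with `e i = ±1`, `c i ∈ C`,
`c i ≠ 1` whenever `e i = -e (i+1)` (indices cyclic), and with fewer than `n` of the `e i`
equal to `+1` and fewer than `n` equal to `-1`, is nontrivial. -/
def IsRF {A : Type} [Group A] (C : Subgroup A) (n : ℕ∞) (a : A) : Prop :=
  ∀ (k : ℕ) (e : Fin (k + 1) → ℤ) (c : Fin (k + 1) → A),
    (∀ i, e i = 1 ∨ e i = -1) → (∀ i, c i ∈ C) →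
    (∀ i, e i = -(e (i + 1)) → c i ≠ 1) →
    ((Finset.univ.filter (fun i => e i = 1)).card : ℕ∞) < n →
    ((Finset.univ.filter (fun i => e i = -1)).card : ℕ∞) < n →
    (List.ofFn fun i => a ^ e i * c i).prod ≠ 1

section HNNSetup

variable {C A : Type} [Group C] [Group A] (iP iN : C →* A)
  (hiP : Function.Injective iP) (hiN : Function.Injective iN)

/-- The isomorphism `i_P(C) ≃* i_N(C)` sending `i_P c` to `i_N c`; the associated HNN extension
`HNNExtension A iP.range iN.range (hnnφ iP iN hiP hiN)` is `⟨A, t ∣ i_N c = t (i_P c) t⁻¹⟩`. -/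
noncomputable def hnnφ : (iP.range : Subgroup A) ≃* (iN.range : Subgroup A) :=
  (MonoidHom.ofInjective hiP).symm.trans (MonoidHom.ofInjective hiN)

/-- The projection `p : A ∗_C → ℤ` with `p t = 1` and `p a = 0` for `a ∈ A`. -/
noncomputable def hnnProj :
    HNNExtension A iP.range iN.range (hnnφ iP iN hiP hiN) →* Multiplicative ℤ :=
  HNNExtension.lift 1 (Multiplicative.ofAdd 1) (fun a => by simp)

end HNNSetup

section AkSetup

variable {C A : Type} [Group C] [Group A] (iP iN : C →* A)
  (hiP : Function.Injective iP) (hiN : Function.Injective iN)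

/-- For `k ≥ 0`, the subgroup `A_k ≤ A ∗_C` generated by `{t⁻ⁱ a tⁱ : a ∈ A, 0 ≤ i ≤ k}`,
with the convention `A_{-1} = i_N(C)` (as a subgroup of the HNN extension). -/
noncomputable def AkSub (k : ℤ) :
    Subgroup (HNNExtension A iP.range iN.range (hnnφ iP iN hiP hiN)) :=
  if k = -1 then Subgroup.map HNNExtension.of iN.range
  else Subgroup.closure
    {x | ∃ a : A, ∃ i : ℤ, 0 ≤ i ∧ i ≤ k ∧
      x = HNNExtension.t ^ (-i) * HNNExtension.of a * HNNExtension.t ^ i}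

/-- The subgroup `t⁻¹ A_k t` of the HNN extension. -/
noncomputable def AkSubConj (k : ℤ) :
    Subgroup (HNNExtension A iP.range iN.range (hnnφ iP iN hiP hiN)) :=
  Subgroup.map (MulAut.conj (HNNExtension.t)⁻¹).toMonoidHom (AkSub iP iN hiP hiN k)

end AkSetup


namespace RFProof

/-- `a` or `a⁻¹`, according to the sign. -/
def sg {G : Type*} [Group G] (a : G) (e : Bool) : G := if e then a else a⁻¹

/-- Linear reduced words in `a` with coefficients in `C`; the list records the signs
(latest first). -/
inductive LW {G : Type*} [Group G] (C : Subgroup G) (a : G) : List Bool → G → Prop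
  | start (e : Bool) : LW C a [e] (sg a e)
  | snoc (e f : Bool) (es : List Bool) (w c : G) : LW C a (e :: es) w → c ∈ C →
      (e ≠ f → c ≠ 1) → LW C a (f :: e :: es) (w * c * sg a f)

/-- Linear version of relative freeness. -/
def LRF {G : Type*} [Group G] (C : Subgroup G) (n : ℕ∞) (a : G) : Prop :=
  ∀ es w, LW C a es w → (∀ b, (es.count b : ℕ∞) < n) → w ∉ C

theorem LW.map {G G' : Type*} [Group G] [Group G'] (f : G →* G') {C : Subgroup G} {a : G}
    {es : List Bool} {w : G'} (h : LW (C.map f) (f a) es w) : ∃ v, LW C a es v ∧ f v = w := by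
  have hs : ∀ e, f (sg a e) = sg (f a) e := by intro e; cases e <;> simp [sg]
  induction h with
  | start e => exact ⟨_, LW.start e, hs e⟩
  | snoc e e' es w c _ hc h1 ih =>
    obtain ⟨v, hv, rfl⟩ := ih
    obtain ⟨d, hd, rfl⟩ := hc
    refine ⟨_, LW.snoc e e' es v d hv hd (fun h hd1 => h1 h (by simp [hd1])), ?_⟩
    simp [hs]

theorem LRF.map {G G' : Type*} [Group G] [Group G'] (f : G →* G') (hf : Function.Injective f)
    {C : Subgroup G} {a : G} {n : ℕ∞} (h : LRF C n a) : LRF (C.map f) n (f a) := by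
  intro es w hw hes hwC
  obtain ⟨v, hv, rfl⟩ := hw.map
  obtain ⟨u, hu, huv⟩ := hwC
  have := hf huv
  subst this
  exact h _ _ hv hes hu

theorem LW.mono {G : Type*} [Group G] {C D : Subgroup G} (hCD : C ≤ D) {a : G}
    {es : List Bool} {w : G} (h : LW C a es w) : LW D a es w := by
  induction h with
  | start e => exact LW.start e
  | snoc e e' es w c _ hc h1 ih => exact LW.snoc e e' es w c ih (hCD hc) h1

theorem LRF.mono {G : Type*} [Group G] {C D : Subgroup G} (hCD : C ≤ D) {a : G} {n : ℕ∞}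
    (h : LRF D n a) : LRF C n a :=
  fun es w hw hes hwC => h es w (hw.mono hCD) hes (hCD hwC)

/-- Multiplying on both sides by elements of the subgroup preserves relative freeness. -/
theorem LRF.twist {G : Type*} [Group G] {D : Subgroup G} {g p q : G} {n : ℕ∞}
    (hp : p ∈ D) (hq : q ∈ D) (h : LRF D n g) : LRF D n (p * g * q) := by
  have key : ∀ es w, LW D (p * g * q) es w → ∃ l ∈ D, ∃ v, LW D g es v ∧
      w = l * v * (if es.head? = some true then q else p⁻¹) := by
    intro es w hw
    induction hw with
    | start e =>
      cases e
      · exact ⟨q⁻¹, D.inv_mem hq, _, LW.start false, by simp [sg, mul_assoc]⟩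
      · exact ⟨p, hp, _, LW.start true, by simp [sg]⟩
    | snoc e e' es w c _ hc h1 ih =>
      obtain ⟨l, hl, v, hv, rfl⟩ := ih
      refine ⟨l, hl, _, LW.snoc e e' es v
        ((if e = true then q else p⁻¹) * c * (if e' = true then p else q⁻¹)) hv ?_ ?_, ?_⟩
      · refine D.mul_mem (D.mul_mem ?_ hc) ?_
        · split_ifs
          exacts [hq, D.inv_mem hp]
        · split_ifs
          exacts [hp, D.inv_mem hq]
      · intro hne h2
        refine h1 hne ?_
        cases e <;> cases e' <;> simp at hne h2 ⊢
        · simpa [inv_mul_eq_one, mul_assoc, eq_inv_mul_iff_mul_eq] using h2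
        · simpa [mul_inv_eq_one] using h2
      · cases e <;> cases e' <;> simp [sg, mul_assoc]
  intro es w hw hes hwD
  obtain ⟨l, hl, v, hv, rfl⟩ := key es w hw
  refine h es v hv hes ?_
  have : (if es.head? = some true then q else p⁻¹) ∈ D := by
    split_ifs
    exacts [hq, D.inv_mem hp]
  rw [D.mul_mem_cancel_right this] at hwD
  rwa [D.mul_mem_cancel_left hl] at hwD

theorem LW.pow {G : Type*} [Group G] (C : Subgroup G) (a : G) (j : ℕ) :
    LW C a (List.replicate (j + 1) true) (a ^ (j + 1)) := by
  induction j with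
  | zero => simpa [sg] using LW.start (C := C) (a := a) true
  | succ j ih =>
    have := LW.snoc true true _ _ 1 ih C.one_mem (by simp)
    simpa [sg, pow_succ, List.replicate_succ] using this

theorem LRF.pow {G : Type*} [Group G] {C : Subgroup G} {a : G} {n : ℕ∞} (h : LRF C n a) (j : ℕ)
    (hj : ((j + 1 : ℕ) : ℕ∞) < n) : a ^ (j + 1) ∉ C := by
  refine h _ _ (LW.pow C a j) ?_
  intro b
  refine lt_of_le_of_lt ?_ hj
  exact_mod_cast (List.count_le_length.trans (by simp))

theorem LRF.malnormal {G : Type*} [Group G] {C : Subgroup G} {a : G} {n : ℕ∞} (hn : 2 ≤ n)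
    (h : LRF C n a) (c : G) (hc : c ∈ C) (hc1 : c ≠ 1) : a * c * a⁻¹ ∉ C := by
  have := LW.snoc true false [] _ c (LW.start (C := C) (a := a) true) hc (fun _ => hc1)
  have := h _ _ this ?_
  · simpa [sg] using this
  · intro b
    refine lt_of_lt_of_le ?_ hn
    cases b <;> simp

/-- Alternating words of odd length with letters in `D i \ C`; `l` is the length. -/
inductive WW {G : Type*} [Group G] (D : Bool → Subgroup G) (C : Subgroup G) :
    ℕ → Bool → G → Prop
  | single (i : Bool) (g : G) : g ∈ D i → g ∉ C → WW D C 1 i g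
  | concat (i j : Bool) (l l' l'' : ℕ) (g h k : G) : i ≠ j → WW D C l i g → WW D C l' j h →
      WW D C l'' i k → WW D C (l + l' + l'') i (g * h * k)

/-- Alternating words of unspecified odd length. -/
def Od {G : Type*} [Group G] (D : Bool → Subgroup G) (C : Subgroup G) (i : Bool) (g : G) : Prop :=
  ∃ l, WW D C l i g

section amalgam

variable {G : Type*} [Group G] {D : Bool → Subgroup G} {C : Subgroup G}

theorem Od.single {i : Bool} {g : G} (h : g ∈ D i) (h' : g ∉ C) : Od D C i g :=
  ⟨1, WW.single i g h h'⟩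

theorem Od.concat {i j : Bool} (hij : i ≠ j) {g h k : G} (hg : Od D C i g) (hh : Od D C j h)
    (hk : Od D C i k) : Od D C i (g * h * k) := by
  obtain ⟨l, hg⟩ := hg
  obtain ⟨l', hh⟩ := hh
  obtain ⟨l'', hk⟩ := hk
  exact ⟨_, WW.concat i j l l' l'' g h k hij hg hh hk⟩

theorem WW.mul_right (hC : ∀ i, C ≤ D i) {l : ℕ} {i : Bool} {g c : G} (h : WW D C l i g)
    (hc : c ∈ C) : WW D C l i (g * c) := by
  induction h with
  | single i g h h' =>
    exact WW.single i _ ((D i).mul_mem h (hC i hc)) (by rwa [C.mul_mem_cancel_right hc])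
  | concat i j l l' l'' g h k hij hg hh hk _ _ ih =>
    rw [mul_assoc (g * h)]
    exact WW.concat i j _ _ _ _ _ _ hij hg hh ih

theorem Od.mul_right (hC : ∀ i, C ≤ D i) {i : Bool} {g c : G} (h : Od D C i g)
    (hc : c ∈ C) : Od D C i (g * c) := by
  obtain ⟨l, h⟩ := h
  exact ⟨l, h.mul_right hC hc⟩

theorem Od.inv {i : Bool} {g : G} (h : Od D C i g) : Od D C i g⁻¹ := by
  obtain ⟨l, h⟩ := h
  induction h with
  | single i g h h' => exact Od.single ((D i).inv_mem h) (by rwa [C.inv_mem_iff])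
  | concat i j l l' l'' g h k hij hg hh hk ihg ihh ihk =>
    have := Od.concat hij ihk ihh ihg
    simpa [mul_assoc] using this

theorem Od.sg {i : Bool} {g : G} (h : Od D C i g) (e : Bool) : Od D C i (sg g e) := by
  cases e
  · exact h.inv
  · exact h

theorem WW.pos {l : ℕ} {i : Bool} {g : G} (h : WW D C l i g) : 0 < l := by
  induction h <;> omega

theorem WW.center {l : ℕ} {i j : Bool} (hij : i ≠ j) {g : G} (h : WW D C l i g) :
    (g ∈ D i ∧ g ∉ C) ∨ ∃ x y k l', l' + 2 ≤ l ∧ x ∈ D i ∧ x ∉ C ∧ y ∈ D i ∧ y ∉ C ∧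
      WW D C l' j k ∧ g = x * k * y := by
  induction h with
  | single i g h h' => exact Or.inl ⟨h, h'⟩
  | concat i j' l l' l'' g h k hij' hg hh hk ihg ihh ihk =>
    obtain rfl : j' = j := by revert hij hij'; cases i <;> cases j <;> cases j' <;> simp
    right
    have hl := hg.pos
    have hl' := hk.pos
    rcases ihg hij with ⟨hx, hxC⟩ | ⟨x, y, m, lm, hlm, hx, hxC, hy, hyC, hm, rfl⟩
    · rcases ihk hij with ⟨hz, hzC⟩ | ⟨z, y', m', lm', hlm', hz, hzC, hy', hyC', hm', rfl⟩
      · exact ⟨g, k, h, l', by omega, hx, hxC, hz, hzC, hh, rfl⟩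
      · exact ⟨g, y', h * z * m', _, by omega, hx, hxC, hy', hyC',
          WW.concat _ _ _ _ _ _ _ _ hij.symm hh (WW.single _ _ hz hzC) hm', by
            simp [mul_assoc]⟩
    · rcases ihk hij with ⟨hz, hzC⟩ | ⟨z, y', m', lm', hlm', hz, hzC, hy', hyC', hm', rfl⟩
      · exact ⟨x, k, m * y * h, _, by omega, hx, hxC, hz, hzC,
          WW.concat _ _ _ _ _ _ _ _ hij.symm hm (WW.single _ _ hy hyC) hh, by
            simp [mul_assoc]⟩
      · exact ⟨x, y', m * y * (h * z * m'), lm + 1 + (l' + 1 + lm'), by omega, hx, hxC, hy', hyC',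
          WW.concat _ _ _ _ _ _ _ _ hij.symm hm (WW.single _ _ hy hyC)
          (WW.concat _ _ _ _ _ _ _ _ hij.symm hh (WW.single _ _ hz hzC) hm'), by
            simp [mul_assoc]⟩

theorem Od.center {i j : Bool} (hij : i ≠ j) {g : G} (h : Od D C i g) :
    (g ∈ D i ∧ g ∉ C) ∨ ∃ x y k, x ∈ D i ∧ x ∉ C ∧ y ∈ D i ∧ y ∉ C ∧
      Od D C j k ∧ g = x * k * y := by
  obtain ⟨l, h⟩ := h
  rcases h.center hij with h | ⟨x, y, m, lm, hlm, hx, hxC, hy, hyC, hm, rfl⟩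
  · exact Or.inl h
  · exact Or.inr ⟨x, y, m, hx, hxC, hy, hyC, ⟨_, hm⟩, rfl⟩

/-- Every element of the subgroup generated is in `D i` or in `D i * Od j * D i`. -/
theorem exists_form (hC : ∀ i, C ≤ D i) {i j : Bool} (hij : i ≠ j) {g : G}
    (hg : g ∈ D i ⊔ D j) :
    g ∈ D i ∨ ∃ p ∈ D i, ∃ q ∈ D i, ∃ k, Od D C j k ∧ g = p * k * q := by
  have hDi : ∀ g, (g ∈ D i ∨ ∃ p ∈ D i, ∃ q ∈ D i, ∃ k, Od D C j k ∧ g = p * k * q) →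
      ∀ b ∈ D i, (g * b ∈ D i ∨ ∃ p ∈ D i, ∃ q ∈ D i, ∃ k, Od D C j k ∧ g * b = p * k * q) := by
    rintro g (hg | ⟨p, hp, q, hq, k, hk, rfl⟩) b hb
    · exact Or.inl ((D i).mul_mem hg hb)
    · exact Or.inr ⟨p, hp, q * b, (D i).mul_mem hq hb, k, hk, by simp [mul_assoc]⟩
  have hDj : ∀ g, (g ∈ D i ∨ ∃ p ∈ D i, ∃ q ∈ D i, ∃ k, Od D C j k ∧ g = p * k * q) →
      ∀ b ∈ D j, (g * b ∈ D i ∨ ∃ p ∈ D i, ∃ q ∈ D i, ∃ k, Od D C j k ∧ g * b = p * k * q) := by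
    intro g hg b hb
    by_cases hbC : b ∈ C
    · exact hDi g hg b (hC i hbC)
    rcases hg with hg | ⟨p, hp, q, hq, k, hk, rfl⟩
    · exact Or.inr ⟨g, hg, 1, (D i).one_mem, b, Od.single hb hbC, by simp⟩
    by_cases hqC : q ∉ C
    · exact Or.inr ⟨p, hp, 1, (D i).one_mem, k * q * b,
        Od.concat hij.symm hk (Od.single hq hqC) (Od.single hb hbC), by simp [mul_assoc]⟩
    rw [not_not] at hqC
    have hb' : q * b ∈ D j := (D j).mul_mem (hC j hqC) hb
    rcases hk.center hij.symm with ⟨hk1, hk2⟩ | ⟨x, y, m, hx, hxC, hy, hyC, hm, rfl⟩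
    · by_cases h : k * (q * b) ∈ C
      · left
        have := (D i).mul_mem hp (hC i h)
        simpa [mul_assoc] using this
      · exact Or.inr ⟨p, hp, 1, (D i).one_mem, k * (q * b),
          Od.single ((D j).mul_mem hk1 hb') h, by simp [mul_assoc]⟩
    · by_cases h : y * (q * b) ∈ C
      · have hm' := hm.mul_right hC h
        rcases hm'.center hij with ⟨h1, h2⟩ | ⟨z, z', r, hz, hzC, hz', hzC', hr, hr'⟩
        · refine Or.inr ⟨p, hp, m * (y * (q * b)), h1, x, Od.single hx hxC, by simp [mul_assoc]⟩
        · refine Or.inr ⟨p, hp, z', hz', x * z * r,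
            Od.concat hij.symm (Od.single hx hxC) (Od.single hz hzC) hr, ?_⟩
          calc p * (x * m * y) * q * b = p * x * (m * (y * (q * b))) := by simp [mul_assoc]
            _ = _ := by rw [hr']; simp [mul_assoc]
      · exact Or.inr ⟨p, hp, 1, (D i).one_mem, x * m * (y * (q * b)),
          Od.concat hij.symm (Od.single hx hxC) hm
            (Od.single ((D j).mul_mem hy hb') h), by simp [mul_assoc]⟩
  rw [Subgroup.sup_eq_closure] at hg
  induction hg using Subgroup.closure_induction_right with
  | one => exact Or.inl (D i).one_mem
  | mul_right x hx y hy ih =>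
    rcases hy with hy | hy
    · exact hDi _ ih _ hy
    · exact hDj _ ih _ hy
  | mul_inv_cancel x hx y hy ih =>
    rcases hy with hy | hy
    · exact hDi _ ih _ ((D i).inv_mem hy)
    · exact hDj _ ih _ ((D j).inv_mem hy)

theorem WW.pow (hC : ∀ i, C ≤ D i) {n : ℕ∞}
    (hRF : ∀ i, ∀ x ∈ D i, x ∉ C → LRF C n x) (l : ℕ) :
    ∀ i h, WW D C l i h → ∀ m : ℕ, ((m + 1 : ℕ) : ℕ∞) < n → Od D C i (h ^ (m + 1)) := by
  induction l using Nat.strong_induction_on with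
  | _ l ih =>
    intro i h hh m hm
    have hij : i ≠ !i := by cases i <;> simp
    rcases hh.center hij with ⟨h1, h2⟩ | ⟨x, y, k, lk, hlk, hx, hxC, hy, hyC, hk, rfl⟩
    · exact Od.single ((D i).pow_mem h1 _) ((hRF i h h1 h2).pow m hm)
    · by_cases hyx : y * x ∈ C
      · have := ih lk (by omega) _ _ (hk.mul_right hC hyx) m hm
        have h3 := Od.concat hij (Od.single hx hxC) this
          (Od.single ((D i).inv_mem hx) (by rwa [C.inv_mem_iff]))
        rw [← conj_pow] at h3
        have h4 : x * (k * (y * x)) * x⁻¹ = x * k * y := by simp [mul_assoc]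
        rwa [h4] at h3
      · have : ∀ m : ℕ, ∃ K, Od D C (!i) K ∧ (x * k * y) ^ (m + 1) = x * K * y := by
          intro m
          induction m with
          | zero => exact ⟨k, ⟨lk, hk⟩, by simp⟩
          | succ m ihm =>
            obtain ⟨K, hK, hKe⟩ := ihm
            refine ⟨K * (y * x) * k, Od.concat hij.symm hK
              (Od.single ((D i).mul_mem hy hx) hyx) ⟨lk, hk⟩, ?_⟩
            rw [pow_succ, hKe]
            simp [mul_assoc]
        obtain ⟨K, hK, hKe⟩ := this m
        rw [hKe]
        exact Od.concat hij (Od.single hx hxC) hK (Od.single hy hyC)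

theorem lt_of_cons {n : ℕ∞} {e : Bool} {es : List Bool}
    (h : ∀ b, ((e :: es).count b : ℕ∞) < n) : ∀ b, (es.count b : ℕ∞) < n := by
  intro b
  refine lt_of_le_of_lt ?_ (h b)
  exact_mod_cast List.count_le_count_cons

/-- Case of a single letter. -/
theorem lrf_single {n : ℕ∞} {i j : Bool}
    (hij : i ≠ j) {b : G} (hb : b ∈ D i) (hC : C ≤ D i)
    (hRF : LRF C n b) (es : List Bool) (w : G) (hw : LW (D j) b es w)
    (hes : ∀ b, (es.count b : ℕ∞) < n) : Od D C i w := by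
  have hLD : ∀ es v, LW C b es v → v ∈ D i := by
    have hs : ∀ e, sg b e ∈ D i := by
      intro e; cases e
      · exact (D i).inv_mem hb
      · exact hb
    intro es v hv
    induction hv with
    | start e => exact hs e
    | snoc e e' es w c _ hc h1 ih =>
      exact (D i).mul_mem ((D i).mul_mem ih (hC hc)) (hs e')
  have key : ∃ u v es', LW C b es' v ∧ es'.head? = es.head? ∧ (∀ b, es'.count b ≤ es.count b) ∧
      w = u * v ∧ (u = 1 ∨ ∃ k c, Od D C i k ∧ c ∈ D j ∧ c ∉ C ∧ u = k * c) := by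
    induction hw with
    | start e => exact ⟨1, _, [e], LW.start e, rfl, fun _ => le_rfl, by simp, Or.inl rfl⟩
    | snoc e e' es w c hw' hc h1 ih =>
      obtain ⟨u, v, es', hv, hhd, hct, rfl, hu⟩ := ih (lt_of_cons hes)
      by_cases hcC : c ∈ C
      · obtain ⟨es'', rfl⟩ : ∃ es'', es' = e :: es'' := by
          cases es' with
          | nil => simp at hhd
          | cons a l => simp at hhd; exact ⟨l, by rw [hhd]⟩
        refine ⟨u, _, _, LW.snoc e e' es'' v c hv hcC h1, by simp, ?_, by simp [mul_assoc], hu⟩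
        intro b
        have := hct b
        rw [List.count_cons, List.count_cons (l := e :: es)]
        omega
      · have hvC : v ∉ C := by
          refine hRF _ _ hv ?_
          intro b
          refine lt_of_le_of_lt ?_ (lt_of_cons hes b)
          exact_mod_cast hct b
        have hvO : Od D C i v := Od.single (hLD _ _ hv) hvC
        refine ⟨u * v * c, _, [e'], LW.start e', by simp, ?_, by simp, Or.inr ⟨u * v, c, ?_, hc, hcC, rfl⟩⟩
        · intro b
          rw [List.count_cons, List.count_cons (l := e :: es)]
          simp
        · rcases hu with rfl | ⟨k, c', hk, hc', hcC', rfl⟩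
          · simpa using hvO
          · exact Od.concat hij hk (Od.single hc' hcC') hvO
  obtain ⟨u, v, es', hv, hhd, hct, rfl, hu⟩ := key
  have hvC : v ∉ C := by
    refine hRF _ _ hv ?_
    intro b
    refine lt_of_le_of_lt ?_ (hes b)
    exact_mod_cast hct b
  have hvO : Od D C i v := Od.single (hLD _ _ hv) hvC
  rcases hu with rfl | ⟨k, d, hk, hd, hdC, rfl⟩
  · simpa using hvO
  · exact Od.concat hij hk (Od.single hd hdC) hvO

/-- Case without cancellation. -/
theorem lrf_nocancel {n : ℕ∞} (hn : 2 ≤ n) (hC : ∀ i, C ≤ D i) {i j : Bool} (hij : i ≠ j)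
    (hRF : ∀ i, ∀ x ∈ D i, x ∉ C → LRF C n x)
    {x y h : G} (hx : x ∈ D i) (hxC : x ∉ C) (hy : y ∈ D i) (hyC : y ∉ C) (hh : Od D C j h)
    (hno : ∀ c ∈ C, y * c * x ∉ C)
    (es : List Bool) (w : G) (hw : LW (D j) (x * h * y) es w) : Od D C i w := by
  have hx' : x⁻¹ ∈ D i := (D i).inv_mem hx
  have hy' : y⁻¹ ∈ D i := (D i).inv_mem hy
  have hxC' : x⁻¹ ∉ C := by rwa [C.inv_mem_iff]
  have hyC' : y⁻¹ ∉ C := by rwa [C.inv_mem_iff]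
  have key : ∃ x' K, x' ∈ D i ∧ x' ∉ C ∧ Od D C j K ∧
      w = x' * K * (if es.head? = some true then y else x⁻¹) := by
    induction hw with
    | start e =>
      cases e
      · exact ⟨y⁻¹, h⁻¹, hy', hyC', hh.inv, by simp [sg, mul_assoc]⟩
      · exact ⟨x, h, hx, hxC, hh, by simp [sg]⟩
    | snoc e e' es w c hw' hc h1 ih =>
      obtain ⟨x', K, h2, h3, hK, rfl⟩ := ih
      have hO : Od D C i ((if e = true then y else x⁻¹) * c * (if e' = true then x else y⁻¹)) := by
        by_cases hcC : c ∈ C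
        · apply Od.single
          · refine (D i).mul_mem ((D i).mul_mem ?_ (hC i hcC)) ?_ <;> split_ifs <;> assumption
          · cases e <;> cases e' <;> simp at h1 ⊢
            · intro h4
              refine hno c⁻¹ (C.inv_mem hcC) ?_
              have := C.inv_mem h4
              simpa [mul_assoc] using this
            · have := (hRF i x⁻¹ hx' hxC').malnormal hn c hcC h1
              simpa using this
            · exact (hRF i y hy hyC).malnormal hn c hcC h1
            · exact hno c hcC
        · refine Od.concat hij ?_ (Od.single hc hcC) ?_
          · split_ifs
            exacts [Od.single hy hyC, Od.single hx' hxC']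
          · split_ifs
            exacts [Od.single hx hxC, Od.single hy' hyC']
      refine ⟨x', _, h2, h3, Od.concat hij.symm hK hO (hh.sg e'), ?_⟩
      cases e' <;> simp [sg, mul_assoc]
  obtain ⟨x', K, h2, h3, hK, rfl⟩ := key
  refine Od.concat hij (Od.single h2 h3) hK ?_
  split_ifs
  exacts [Od.single hy hyC, Od.single hx' hxC']

/-- Case of a conjugate. -/
theorem lrf_conj {n : ℕ∞} (hn : 2 ≤ n) (hC : ∀ i, C ≤ D i) {i j : Bool} (hij : i ≠ j)
    (hRF : ∀ i, ∀ x ∈ D i, x ∉ C → LRF C n x)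
    {x h : G} (hx : x ∈ D i) (hxC : x ∉ C) (hh : Od D C j h)
    (es : List Bool) (w : G) (hw : LW (D j) (x * h * x⁻¹) es w)
    (hes : ∀ b, (es.count b : ℕ∞) < n) : Od D C i w := by
  have hx' : x⁻¹ ∈ D i := (D i).inv_mem hx
  have hxC' : x⁻¹ ∉ C := by rwa [C.inv_mem_iff]
  have hpow : ∀ e (m : ℕ), ((m + 1 : ℕ) : ℕ∞) < n → Od D C j (sg h e ^ (m + 1)) := by
    intro e m hm
    obtain ⟨l, hl⟩ := hh.sg e
    exact hl.pow hC hRF l _ _ m hm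
  have hsg : ∀ e, sg (x * h * x⁻¹) e = x * sg h e * x⁻¹ := by
    intro e; cases e <;> simp [sg, mul_assoc]
  have key : ∃ u e es' m, es = e :: es' ∧ Od D C i u ∧ m + 1 ≤ es.count e ∧
      w = u * sg h e ^ (m + 1) * x⁻¹ := by
    induction hw with
    | start e => exact ⟨x, e, [], 0, rfl, Od.single hx hxC, by simp, by simp [hsg]⟩
    | snoc e e' es w c hw' hc h1 ih =>
      obtain ⟨u, e0, es0, m, he, hu, hm, rfl⟩ := ih (lt_of_cons hes)
      obtain ⟨rfl, rfl⟩ : e = e0 ∧ es = es0 := by simpa using he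
      by_cases hc1 : c = 1
      · subst hc1
        have hee : e = e' := by
          by_contra hne
          exact h1 hne rfl
        subst hee
        refine ⟨u, e, _, m + 1, rfl, hu, ?_, ?_⟩
        · rw [List.count_cons]; simp only [beq_self_eq_true, if_true]; omega
        · rw [hsg, pow_succ _ (m + 1)]; simp [mul_assoc]
      · have hO : Od D C i (x⁻¹ * c * x) := by
          by_cases hcC : c ∈ C
          · apply Od.single
            · exact (D i).mul_mem ((D i).mul_mem hx' (hC i hcC)) hx
            · have := (hRF i x⁻¹ hx' hxC').malnormal hn c hcC hc1
              simpa using this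
          · exact Od.concat hij (Od.single hx' hxC') (Od.single hc hcC) (Od.single hx hxC)
        refine ⟨u * sg h e ^ (m + 1) * (x⁻¹ * c * x), e', _, 0, rfl, ?_, ?_, ?_⟩
        · refine Od.concat hij hu (hpow e m ?_) hO
          refine lt_of_le_of_lt ?_ (lt_of_cons hes e)
          exact_mod_cast hm
        · simp
        · rw [hsg]; simp [mul_assoc]
  obtain ⟨u, e, es', m, rfl, hu, hm, rfl⟩ := key
  refine Od.concat hij hu (hpow e m ?_) (Od.single hx' hxC')
  refine lt_of_le_of_lt ?_ (hes e)
  exact_mod_cast hm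

/-- The amalgam lemma. -/
theorem lrf_amalgam {n : ℕ∞} (hn : 2 ≤ n) (hC : ∀ i, C ≤ D i)
    (hW : ∀ i j, i ≠ j → ∀ g, Od D C i g → g ∉ D j)
    (hRF : ∀ i, ∀ x ∈ D i, x ∉ C → LRF C n x) {i j : Bool} (hij : i ≠ j)
    (g : G) (hg : g ∈ D j ⊔ D i) (hgD : g ∉ D j) : LRF (D j) n g := by
  obtain h | ⟨p, hp, q, hq, k, hk, rfl⟩ := exists_form hC hij.symm hg
  · exact absurd h hgD
  apply LRF.twist hp hq
  rcases hk.center hij with ⟨h1, h2⟩ | ⟨x, y, m, hx, hxC, hy, hyC, hm, rfl⟩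
  · intro es w hw hes
    exact hW i j hij w (lrf_single hij h1 (hC i) (hRF i _ h1 h2) es w hw hes)
  · by_cases hno : ∀ c ∈ C, y * c * x ∉ C
    · intro es w hw hes
      exact hW i j hij w (lrf_nocancel hn hC hij hRF hx hxC hy hyC hm hno es w hw)
    · push Not at hno
      obtain ⟨c, hc, hycx⟩ := hno
      have h3 : LRF (D j) n (x * (m * (y * c * x)) * x⁻¹) := by
        intro es w hw hes
        exact hW i j hij w (lrf_conj hn hC hij hRF hx hxC (hm.mul_right hC hycx) es w hw hes)
      have h4 := LRF.twist (D j).one_mem ((D j).inv_mem (hC j hc)) h3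
      have h5 : 1 * (x * (m * (y * c * x)) * x⁻¹) * c⁻¹ = x * m * y := by simp [mul_assoc]
      rwa [h5] at h4

end amalgam

/-- Elements with a Britton-reduced expression which starts with `s⁻¹` and ends with `s`. -/
inductive RR {H : Type*} [Group H] (A P N : Subgroup H) (s : H) : H → Prop
  | base (a : H) : a ∈ A → a ∉ N → RR A P N s (s⁻¹ * a * s)
  | mul (x a y : H) : RR A P N s x → a ∈ A → a ∉ P → RR A P N s y → RR A P N s (x * a * y)
  | wrap (a x b : H) : a ∈ A → RR A P N s x → b ∈ A → RR A P N s (s⁻¹ * (a * x * b) * s)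

/-- The tower of subgroups `A_k`. -/
def TA {H : Type*} [Group H] (A : Subgroup H) (s : H) : ℕ → Subgroup H
  | 0 => A
  | k + 1 => A ⊔ (TA A s k).map (MulAut.conj s⁻¹).toMonoidHom

section tower

variable {H : Type*} [Group H] {A P N : Subgroup H} {s : H}

theorem conj_inv_apply (u x : H) : (MulAut.conj u⁻¹).toMonoidHom x = u⁻¹ * x * u := by
  simp

theorem le_TA (k : ℕ) : A ≤ TA A s k := by
  cases k with
  | zero => exact le_rfl
  | succ k => exact le_sup_left

/-- The two factors of the amalgam. -/
def DD (A : Subgroup H) (s : H) (k : ℕ) (i : Bool) : Subgroup H :=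
  if i then A else (TA A s k).map (MulAut.conj s⁻¹).toMonoidHom

theorem conj_mem_iff (hPN : N.map (MulAut.conj s⁻¹).toMonoidHom = P) (x : H) :
    s⁻¹ * x * s ∈ P ↔ x ∈ N := by
  rw [← hPN]
  constructor
  · rintro ⟨y, hy, hxy⟩
    have : y = x := by simpa using hxy
    rwa [← this]
  · intro hx
    exact ⟨x, hx, by simp⟩

theorem od_false (hPN : N.map (MulAut.conj s⁻¹).toMonoidHom = P) {k : ℕ}
    (hk : ∀ x ∈ TA A s k, x ∉ N → RR A P N s (s⁻¹ * x * s)) {i : Bool} {g : H}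
    (hg : Od (DD A s k) P i g) :
    (i = false → RR A P N s g) ∧
      (i = true → ∀ x y, RR A P N s x → RR A P N s y → RR A P N s (x * g * y)) := by
  obtain ⟨l, hg⟩ := hg
  induction hg with
  | single i g h h' =>
    cases i
    · refine ⟨fun _ => ?_, by simp⟩
      obtain ⟨y, hy, rfl⟩ := h
      have h2 : (MulAut.conj s⁻¹).toMonoidHom y = s⁻¹ * y * s := by simp
      rw [h2] at h' ⊢
      rw [conj_mem_iff hPN] at h'
      exact hk y hy h'
    · refine ⟨by simp, fun _ x y hx hy => ?_⟩
      exact RR.mul x g y hx h h' hy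
  | concat i j l l' l'' g h r hij hg hh hr ihg ihh ihr =>
    cases i <;> cases j <;> simp at hij ihg ihh ihr ⊢
    · exact ihh _ _ ihg ihr
    · intro x y hx hy
      have := ihg x _ hx (ihr h y ihh hy)
      simpa [mul_assoc] using this

theorem tower_hW (hPA : P ≤ A)
    (hPN : N.map (MulAut.conj s⁻¹).toMonoidHom = P)
    (hR : ∀ x, RR A P N s x → x ∉ A) {k : ℕ}
    (hk : ∀ x ∈ TA A s k, x ∉ N → RR A P N s (s⁻¹ * x * s)) :
    ∀ i j, i ≠ j → ∀ g, Od (DD A s k) P i g → g ∉ DD A s k j := by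
  have hf : ∀ g, Od (DD A s k) P false g → g ∉ A := fun g hg =>
    hR g ((od_false hPN hk hg).1 rfl)
  intro i j hij g hg
  cases i <;> cases j <;> simp at hij
  · exact hf g hg
  · intro hgB
    rcases hg.center (j := false) (by simp) with
      ⟨h1, h2⟩ | ⟨x, y, m, hx, hxC, hy, hyC, hm, rfl⟩
    · exact hf g (Od.single hgB h2) h1
    · have hx : x ∈ A := hx
      have hy' : y ∈ A := hy
      by_cases hgP : x * m * y ∈ P
      · refine hf m hm ?_
        have := A.mul_mem (A.mul_mem (A.inv_mem hx) (hPA hgP)) (A.inv_mem hy')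
        simpa [mul_assoc] using this
      · have h3 := Od.concat (by simp) hm (Od.single hy hyC)
          (Od.single ((DD A s k false).inv_mem hgB) (by rwa [P.inv_mem_iff]))
        refine hf _ h3 ?_
        have := A.inv_mem hx
        simpa [mul_assoc] using this

theorem tower_aux {n : ℕ∞} (hn : 2 ≤ n) (hPA : P ≤ A) (hNA : N ≤ A)
    (hPN : N.map (MulAut.conj s⁻¹).toMonoidHom = P)
    (hR : ∀ x, RR A P N s x → x ∉ A)
    (hP : ∀ a ∈ A, a ∉ P → LRF P n a) (hN : ∀ a ∈ A, a ∉ N → LRF N n a) (k : ℕ) :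
    (∀ x ∈ TA A s k, x ∉ N → LRF N n x) ∧
    (∀ x ∈ TA A s k, x ∉ N → RR A P N s (s⁻¹ * x * s)) ∧
    (∀ x ∈ TA A s (k + 1), x ∉ (TA A s k).map (MulAut.conj s⁻¹).toMonoidHom →
      LRF ((TA A s k).map (MulAut.conj s⁻¹).toMonoidHom) n x) := by
  have hPB : ∀ k, P ≤ DD A s k false := by
    intro k
    rw [← hPN]
    exact Subgroup.map_mono (hNA.trans (le_TA k))
  have hC : ∀ k i, P ≤ DD A s k i := by
    intro k i
    cases i
    · exact hPB k
    · exact hPA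
  have hRF : ∀ k, (∀ x ∈ TA A s k, x ∉ N → LRF N n x) →
      ∀ i, ∀ x ∈ DD A s k i, x ∉ P → LRF P n x := by
    intro k h1 i x hx hxP
    cases i
    · obtain ⟨y, hy, rfl⟩ := hx
      have hyN : y ∉ N := by
        intro hyN
        apply hxP
        rw [← hPN]
        exact ⟨y, hyN, rfl⟩
      have := (h1 y hy hyN).map (MulAut.conj s⁻¹).toMonoidHom (MulAut.conj s⁻¹).injective
      rwa [hPN] at this
    · exact hP x hx hxP
  have main : ∀ k, (∀ x ∈ TA A s k, x ∉ N → LRF N n x) ∧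
      (∀ x ∈ TA A s k, x ∉ N → RR A P N s (s⁻¹ * x * s)) := by
    intro k
    induction k with
    | zero => exact ⟨hN, fun x hx hxN => RR.base x hx hxN⟩
    | succ k ih =>
      obtain ⟨ih1, ih2⟩ := ih
      have hW := tower_hW hPA hPN hR ih2
      constructor
      · intro x hx hxN
        by_cases hxA : x ∈ A
        · exact hN x hxA hxN
        · exact (lrf_amalgam hn (hC k) hW (hRF k ih1) (i := false) (j := true) (by simp) x hx
            hxA).mono hNA
      · intro x hx hxN
        rcases exists_form (hC k) (i := true) (j := false) (by simp) hx with
          h | ⟨p, hp, q, hq, m, hm, rfl⟩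
        · exact RR.base x h hxN
        · exact RR.wrap p m q hp ((od_false hPN ih2 hm).1 rfl) hq
  obtain ⟨ih1, ih2⟩ := main k
  refine ⟨ih1, ih2, fun x hx hxB => ?_⟩
  have hW := tower_hW hPA hPN hR ih2
  refine lrf_amalgam hn (hC k) hW (hRF k ih1) (i := true) (j := false) (by simp) x ?_ hxB
  rw [sup_comm]
  exact hx

theorem TA_eq_closure (k : ℕ) : TA A s k =
    Subgroup.closure {x | ∃ a ∈ A, ∃ i : ℕ, i ≤ k ∧ x = (s ^ i)⁻¹ * a * s ^ i} := by
  induction k with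
  | zero =>
    rw [TA]
    conv_lhs => rw [← Subgroup.closure_eq A]
    congr 1
    ext x
    simp
  | succ k ih =>
    rw [TA, ih, MonoidHom.map_closure]
    apply le_antisymm
    · refine sup_le ?_ ?_
      · intro a ha
        exact Subgroup.subset_closure ⟨a, ha, 0, by omega, by simp⟩
      · rw [Subgroup.closure_le]
        rintro _ ⟨_, ⟨a, ha, i, hi, rfl⟩, rfl⟩
        exact Subgroup.subset_closure ⟨a, ha, i + 1, by omega, by simp [pow_succ, mul_assoc]⟩
    · rw [Subgroup.closure_le]
      rintro _ ⟨a, ha, i, hi, rfl⟩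
      cases i with
      | zero => exact (le_sup_left : A ≤ _) (by simpa using ha)
      | succ i =>
        refine (le_sup_right : _ ≤ A ⊔ _) (Subgroup.subset_closure
          ⟨_, ⟨a, ha, i, by omega, rfl⟩, by simp [pow_succ, mul_assoc]⟩)

/-- Reversing the direction of the tower. -/
theorem TA_inv (k : ℕ) :
    (TA A s⁻¹ k).map (MulAut.conj (s ^ k)⁻¹).toMonoidHom = TA A s k := by
  rw [TA_eq_closure, TA_eq_closure, MonoidHom.map_closure]
  congr 1
  ext x
  constructor
  · rintro ⟨_, ⟨a, ha, i, hi, rfl⟩, rfl⟩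
    obtain ⟨j, rfl⟩ := Nat.exists_eq_add_of_le hi
    refine ⟨a, ha, j, by omega, ?_⟩
    rw [conj_inv_apply, pow_add]
    group
  · rintro ⟨a, ha, i, hi, rfl⟩
    obtain ⟨j, rfl⟩ := Nat.exists_eq_add_of_le' hi
    refine ⟨_, ⟨a, ha, j, by omega, rfl⟩, ?_⟩
    rw [conj_inv_apply, pow_add]
    group

theorem tower_second {n : ℕ∞} (k : ℕ)
    (h : ∀ x ∈ TA A s⁻¹ (k + 1), x ∉ (TA A s⁻¹ k).map (MulAut.conj s⁻¹⁻¹).toMonoidHom →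
      LRF ((TA A s⁻¹ k).map (MulAut.conj s⁻¹⁻¹).toMonoidHom) n x) :
    ∀ x ∈ TA A s (k + 1), x ∉ TA A s k → LRF (TA A s k) n x := by
  have e : ((TA A s⁻¹ k).map (MulAut.conj s⁻¹⁻¹).toMonoidHom).map
      (MulAut.conj (s ^ (k + 1))⁻¹).toMonoidHom = TA A s k := by
    rw [← TA_inv (A := A) (s := s) k, Subgroup.map_map]
    congr 1
    ext x
    rw [MonoidHom.comp_apply, conj_inv_apply, conj_inv_apply, conj_inv_apply, pow_succ]
    group
  intro x hx hxk
  rw [← TA_inv (k + 1)] at hx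
  obtain ⟨y, hy, rfl⟩ := hx
  have := (h y hy ?_).map (MulAut.conj (s ^ (k + 1))⁻¹).toMonoidHom
    (MulAut.conj (s ^ (k + 1))⁻¹).injective
  · rwa [e] at this
  · intro hy'
    apply hxk
    rw [← e]
    exact ⟨y, hy', rfl⟩

end tower

section convert

variable {G : Type} [Group G]

/-- Linear words indexed by natural numbers. -/
def fw (a : G) (e : ℕ → Bool) (c : ℕ → G) : ℕ → G
  | 0 => sg a (e 0)
  | r + 1 => fw a e c r * c r * sg a (e (r + 1))

theorem fw_shift (a : G) (e : ℕ → Bool) (c : ℕ → G) (r : ℕ) :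
    fw a e c (r + 1) =
      sg a (e 0) * c 0 * fw a (fun i => e (i + 1)) (fun i => c (i + 1)) r := by
  induction r with
  | zero => simp [fw]
  | succ r ih => rw [fw, ih, fw]; simp [mul_assoc]

theorem fw_congr (a : G) (e e' : ℕ → Bool) (c c' : ℕ → G) (r : ℕ)
    (he : ∀ i ≤ r, e i = e' i) (hc : ∀ i < r, c i = c' i) : fw a e c r = fw a e' c' r := by
  induction r with
  | zero => simp [fw, he]
  | succ r ih =>
    rw [fw, fw, ih (fun i hi => he i (by omega)) (fun i hi => hc i (by omega)),
      he (r + 1) le_rfl, hc r (by omega)]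

theorem fw_prod (a : G) (e : ℕ → Bool) (c : ℕ → G) (r : ℕ) :
    (List.ofFn fun i : Fin (r + 1) => sg a (e i) * c i).prod = fw a e c r * c r := by
  induction r with
  | zero => simp [fw]
  | succ r ih =>
    rw [List.ofFn_succ', List.concat_eq_append, List.prod_append]
    simp only [Fin.val_castSucc, Fin.val_last, List.prod_singleton]
    rw [ih, fw]
    simp [mul_assoc]

/-- The list of signs of a linear word. -/
def esl (e : ℕ → Bool) : ℕ → List Bool
  | 0 => [e 0]
  | r + 1 => e (r + 1) :: esl e r

theorem esl_count (e : ℕ → Bool) (b : Bool) (r : ℕ) :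
    (esl e r).count b = (Finset.univ.filter (fun i : Fin (r + 1) => e i = b)).card := by
  rw [Finset.card_filter]
  induction r with
  | zero => by_cases h : e 0 = b <;> simp [esl, h]
  | succ r ih =>
    rw [esl, List.count_cons, ih, Fin.sum_univ_castSucc (n := r + 1)]
    simp only [Fin.val_castSucc, Fin.val_last, beq_iff_eq]

theorem esl_shift_count (e : ℕ → Bool) (b : Bool) (r : ℕ) :
    (esl (fun i => e (i + 1)) r).count b ≤ (esl e (r + 1)).count b := by
  induction r with
  | zero => simp [esl, List.count_cons]
  | succ r ih => rw [esl, List.count_cons, esl, List.count_cons]; omega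

theorem esl_head (e : ℕ → Bool) (r : ℕ) : ∃ l, esl e r = e r :: l := by
  cases r <;> exact ⟨_, rfl⟩

theorem lw_of_fw (C : Subgroup G) (a : G) (e : ℕ → Bool) (c : ℕ → G) (r : ℕ)
    (hc : ∀ i < r, c i ∈ C) (h1 : ∀ i < r, e i ≠ e (i + 1) → c i ≠ 1) :
    LW C a (esl e r) (fw a e c r) := by
  induction r with
  | zero => exact LW.start _
  | succ r ih =>
    have := ih (fun i hi => hc i (by omega)) (fun i hi => h1 i (by omega))
    obtain ⟨l, hl⟩ := esl_head e r
    rw [esl]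
    rw [hl] at this ⊢
    exact LW.snoc _ _ _ _ _ this (hc r (by omega)) (h1 r (by omega))

theorem fw_of_lw (C : Subgroup G) (a : G) (es : List Bool) (w : G) (h : LW C a es w) :
    ∃ (e : ℕ → Bool) (c : ℕ → G) (r : ℕ), es = esl e r ∧ w = fw a e c r ∧
      (∀ i < r, c i ∈ C) ∧ (∀ i < r, e i ≠ e (i + 1) → c i ≠ 1) := by
  induction h with
  | start e => exact ⟨fun _ => e, fun _ => 1, 0, rfl, rfl, by simp, by simp⟩
  | snoc e0 e' es w d _ hd h1 ih =>
    obtain ⟨e, c, r, he, rfl, hc, h2⟩ := ih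
    have hesl : ∀ (f f' : ℕ → Bool) m, (∀ i ≤ m, f i = f' i) → esl f m = esl f' m := by
      intro f f' m
      induction m with
      | zero => intro h; simp [esl, h]
      | succ m ihm => intro h; rw [esl, esl, h _ le_rfl, ihm (fun i hi => h i (by omega))]
    refine ⟨fun i => if i ≤ r then e i else e', fun i => if i < r then c i else d, r + 1,
      ?_, ?_, ?_, ?_⟩
    · rw [esl, he]
      congr 1
      · simp
      · exact hesl _ _ _ (fun i hi => by simp [hi])
    · rw [fw]
      simp only [lt_irrefl, if_false]
      rw [fw_congr a e (fun i => if i ≤ r then e i else e') c (fun i => if i < r then c i else d) r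
        (fun i hi => by simp [hi]) (fun i hi => by simp [hi])]
      simp
    · intro i hi
      by_cases hir : i < r
      · simp [hir, hc]
      · simp [hir, hd]
    · intro i hi
      by_cases hir : i < r
      · have : i + 1 ≤ r := hir
        simpa [hir, hir.le, this] using h2 i hir
      · obtain rfl : i = r := by omega
        obtain ⟨l, hl⟩ := esl_head e i
        rw [hl] at he
        have : e0 = e i := by simpa using (List.cons.inj he).1
        simpa [this] using h1

theorem lrf_of_isRF {C : Subgroup G} {n : ℕ∞} {a : G} (h : IsRF C n a) : LRF C n a := by
  have key : ∀ r : ℕ, ∀ (e : ℕ → Bool) (c : ℕ → G), (∀ i < r, c i ∈ C) →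
      (∀ i < r, e i ≠ e (i + 1) → c i ≠ 1) → (∀ b, ((esl e r).count b : ℕ∞) < n) →
      fw a e c r ∉ C := by
    intro r
    induction r using Nat.strong_induction_on with
    | _ r ih =>
      intro e c hc h1 hct hmem
      by_cases hcyc : e r ≠ e 0 → fw a e c r ≠ 1
      · let c' : ℕ → G := fun i => if i < r then c i else (fw a e c r)⁻¹
        have hsg : ∀ i, sg a (e i) = a ^ (if e i then (1 : ℤ) else -1) := by
          intro i; cases e i <;> simp [sg]
        have := h r (fun i => if e i then (1 : ℤ) else -1) (fun i => c' i) ?_ ?_ ?_ ?_ ?_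
        · apply this
          have h3 := fw_prod a e c' r
          simp only [hsg] at h3
          rw [h3, fw_congr a e e c' c r (fun _ _ => rfl) (fun i hi => by simp [c', hi])]
          simp [c']
        · intro i
          by_cases hi : e i <;> simp [hi]
        · intro i
          by_cases hi : (i : ℕ) < r
          · simpa [c', hi] using hc i hi
          · simpa [c', hi] using hmem
        · intro i hi
          have hi' : e i ≠ e ((i + 1 : Fin (r + 1)) : ℕ) := by
            intro h4
            simp only [h4] at hi
            split_ifs at hi <;> omega
          by_cases hir : (i : ℕ) < r
          · have h5 : ((i + 1 : Fin (r + 1)) : ℕ) = i + 1 := by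
              rw [Fin.val_add_one_of_lt]
              rw [Fin.lt_def]; simpa using hir
            rw [h5] at hi'
            simpa [c', hir] using h1 i hir hi'
          · obtain rfl : i = Fin.last r := by
              apply Fin.ext; have := i.2; simp; omega
            simp only [Fin.last_add_one, Fin.val_last, Fin.val_zero] at hi'
            simpa [c'] using hcyc hi'
        · have := hct true
          rw [esl_count] at this
          convert this using 5
          simp
        · have := hct false
          rw [esl_count] at this
          convert this using 5
          rename_i i _
          cases e i <;> simp
      · push Not at hcyc
        obtain ⟨hne, h1'⟩ := hcyc
        match r, ih, hc, h1, hct, hne, h1' with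
        | 0, _, _, _, _, hne, _ => exact hne rfl
        | 1, _, hc, h1, _, hne, h1' =>
          refine h1 0 (by omega) hne.symm ?_
          simp only [fw, zero_add] at h1'
          have h6 : c 0 = (sg a (e 0))⁻¹ * (sg a (e 1))⁻¹ := by
            rw [mul_eq_one_iff_eq_inv] at h1'
            rw [← h1']; simp
          rw [h6]
          revert hne
          cases e 0 <;> cases e 1 <;> simp [sg]
        | r + 2, ih, hc, h1, hct, hne, h1' =>
          refine ih r (by omega) (fun i => e (i + 1)) (fun i => c (i + 1))
            (fun i hi => hc _ (by omega)) (fun i hi => h1 _ (by omega)) ?_ ?_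
          · intro b
            refine lt_of_le_of_lt ?_ (hct b)
            have h7 := esl_shift_count e b r
            have h8 : (esl e (r + 2)).count b ≥ (esl e (r + 1)).count b := by
              rw [esl, List.count_cons]; omega
            exact_mod_cast h7.trans h8
          · rw [fw, fw_shift] at h1'
            set v := fw a (fun i => e (i + 1)) (fun i => c (i + 1)) r
            have h9 : sg a (e (r + 2)) = (sg a (e 0))⁻¹ := by
              revert hne
              cases e 0 <;> cases e (r + 2) <;> simp [sg]
            rw [h9] at h1'
            have h10 : v = (c 0)⁻¹ * (c (r + 1))⁻¹ := by
              rw [mul_inv_eq_one] at h1'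
              have h11 : c 0 * v * c (r + 1) = 1 := by
                have := congrArg (fun z => (sg a (e 0))⁻¹ * z) h1'
                simpa [mul_assoc] using this
              rw [mul_eq_one_iff_eq_inv] at h11
              rw [← h11]; simp
            rw [h10]
            exact C.mul_mem (C.inv_mem (hc _ (by omega))) (C.inv_mem (hc _ (by omega)))
  intro es w hw hes
  obtain ⟨e, c, r, rfl, rfl, hc, h1⟩ := fw_of_lw C a es w hw
  exact key r e c hc h1 hes

theorem isRF_of_lrf {C : Subgroup G} {n : ℕ∞} {a : G} (h : LRF C n a) : IsRF C n a := by
  intro k e c he hc h1 hp hm hprod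
  let e' : ℕ → Bool := fun i => decide (e (Fin.ofNat (k + 1) i) = 1)
  let c' : ℕ → G := fun i => c (Fin.ofNat (k + 1) i)
  have hfn : ∀ i : Fin (k + 1), Fin.ofNat (k + 1) (i : ℕ) = i := by
    intro i; simp
  have h2 : (fun i : Fin (k + 1) => a ^ e i * c i) =
      fun i : Fin (k + 1) => sg a (e' i) * c' i := by
    funext i
    simp only [e', c', hfn]
    rcases he i with h | h <;> simp [h, sg]
  rw [h2, fw_prod] at hprod
  refine h _ _ (lw_of_fw C a e' c' k (fun i _ => hc _) ?_) ?_ ?_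
  · intro i hi hne
    apply h1
    have h3 : Fin.ofNat (k + 1) i + 1 = Fin.ofNat (k + 1) (i + 1) := by
      apply Fin.ext
      simp [Fin.val_add]
    rw [h3]
    simp only [e'] at hne
    rcases he (Fin.ofNat (k + 1) i) with h4 | h4 <;>
      rcases he (Fin.ofNat (k + 1) (i + 1)) with h5 | h5 <;> simp only [h4, h5] at hne ⊢ <;>
      simp at hne ⊢
  · intro b
    rw [esl_count]
    cases b
    · convert hm using 5
      rename_i i _
      simp only [e', hfn]
      rcases he i with h | h <;> simp [h]
    · convert hp using 5
      rename_i i _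
      simp only [e', hfn]
      rcases he i with h | h <;> simp [h]
  · rw [mul_eq_one_iff_eq_inv] at hprod
    rw [hprod]
    exact C.inv_mem (hc _)

end convert

section britton

open HNNExtension

variable {G : Type*} [Group G] {A B : Subgroup G} (φ : A ≃* B)

theorem britton_list (u : ℤˣ) (x : HNNExtension G A B φ)
    (hx : RR (HNNExtension.of.range : Subgroup (HNNExtension G A B φ))
      ((toSubgroup A B u).map HNNExtension.of) ((toSubgroup A B (-u)).map HNNExtension.of)
      (HNNExtension.t ^ (u : ℤ)) x) :
    ∀ a : G, ∃ l : List (ℤˣ × G),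
      l.IsChain (fun a b => a.2 ∈ toSubgroup A B a.1 → a.1 = b.1) ∧
      (∀ y ∈ l.head?, y.1 = -u) ∧ l.getLast? = some (u, a) ∧
      (l.map (fun y => (HNNExtension.t ^ (y.1 : ℤ) * HNNExtension.of y.2 :
        HNNExtension G A B φ))).prod = x * HNNExtension.of a := by
  induction hx with
  | base b hb hbN =>
    obtain ⟨b, rfl⟩ := hb
    intro a
    have hb' : b ∉ toSubgroup A B (-u) := fun h => hbN ⟨b, h, rfl⟩
    refine ⟨[(-u, b), (u, a)], ?_, ?_, ?_, ?_⟩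
    · simp [hb']
    · simp
    · simp
    · simp [mul_assoc]
  | mul x b y hx hb hbP hy ihx ihy =>
    obtain ⟨b, rfl⟩ := hb
    intro a
    have hb' : b ∉ toSubgroup A B u := fun h => hbP ⟨b, h, rfl⟩
    obtain ⟨l, hl1, hl2, hl3, hl4⟩ := ihx b
    obtain ⟨m, hm1, hm2, hm3, hm4⟩ := ihy a
    have hlne : l ≠ [] := by rintro rfl; simp at hl3
    refine ⟨l ++ m, ?_, ?_, ?_, ?_⟩
    · rw [List.isChain_append]
      refine ⟨hl1, hm1, ?_⟩
      intro p hp q hq hpA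
      rw [hl3] at hp
      obtain rfl : (u, b) = p := by simpa using hp
      exact absurd hpA hb'
    · rw [List.head?_append_of_ne_nil _ hlne]
      exact hl2
    · simp [hm3]
    · simp [hl4, hm4, mul_assoc]
  | wrap b x b' hb hx hb' ih =>
    obtain ⟨b, rfl⟩ := hb
    obtain ⟨b', rfl⟩ := hb'
    intro a
    obtain ⟨l, hl1, hl2, hl3, hl4⟩ := ih b'
    refine ⟨(-u, b) :: (l ++ [(u, a)]), ?_, ?_, ?_, ?_⟩
    · have hlne : l ≠ [] := by rintro rfl; simp at hl3
      rw [List.isChain_cons, List.isChain_append, List.head?_append_of_ne_nil _ hlne]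
      refine ⟨fun y hy _ => (hl2 y hy).symm, hl1, by simp, ?_⟩
      intro p hp q hq hpA
      rw [hl3] at hp
      obtain rfl : (u, b') = p := by simpa using hp
      obtain rfl : (u, a) = q := by simpa using hq
      rfl
    · simp
    · rw [← List.cons_append, List.getLast?_append]
      simp
    · simp [hl4, mul_assoc]

theorem britton (u : ℤˣ) (x : HNNExtension G A B φ)
    (hx : RR (HNNExtension.of.range : Subgroup (HNNExtension G A B φ))
      ((toSubgroup A B u).map HNNExtension.of) ((toSubgroup A B (-u)).map HNNExtension.of)
      (HNNExtension.t ^ (u : ℤ)) x) :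
    x ∉ (HNNExtension.of.range : Subgroup (HNNExtension G A B φ)) := by
  intro hxA
  obtain ⟨l, hl1, hl2, hl3, hl4⟩ := britton_list φ u x hx 1
  have := ReducedWord.toList_eq_nil_of_mem_of_range φ
    (⟨1, l, hl1⟩ : NormalWord.ReducedWord G A B) (by
      rw [NormalWord.ReducedWord.prod]
      simpa [hl4] using hxA)
  simp only at this
  subst this
  simp at hl3

theorem map_conj_inv_t :
    (B.map HNNExtension.of).map
      (MulAut.conj (HNNExtension.t : HNNExtension G A B φ)⁻¹).toMonoidHom =
      A.map HNNExtension.of := by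
  ext x
  constructor
  · rintro ⟨_, ⟨b, hb, rfl⟩, rfl⟩
    refine ⟨φ.symm ⟨b, hb⟩, (φ.symm ⟨b, hb⟩).2, ?_⟩
    rw [conj_inv_apply, equiv_symm_eq_conj]
  · rintro ⟨a, ha, rfl⟩
    refine ⟨_, ⟨φ ⟨a, ha⟩, (φ ⟨a, ha⟩).2, rfl⟩, ?_⟩
    rw [conj_inv_apply, equiv_eq_conj]
    simp [mul_assoc]

theorem map_conj_t :
    (A.map HNNExtension.of).map
      (MulAut.conj (HNNExtension.t : HNNExtension G A B φ)⁻¹⁻¹).toMonoidHom =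
      B.map HNNExtension.of := by
  rw [← map_conj_inv_t φ, Subgroup.map_map]
  convert Subgroup.map_id _
  refine MonoidHom.ext fun x => ?_
  simp [mul_assoc]

/-- The theorem for the towers inside an arbitrary HNN extension. -/
theorem hnn_tower {n : ℕ∞} (hn : 2 ≤ n)
    (hA : ∀ a, a ∉ A → LRF A n a) (hB : ∀ a, a ∉ B → LRF B n a) (k : ℕ) :
    (∀ x ∈ TA (HNNExtension.of.range : Subgroup (HNNExtension G A B φ)) HNNExtension.t (k + 1),
      x ∉ (TA HNNExtension.of.range HNNExtension.t k).map
        (MulAut.conj HNNExtension.t⁻¹).toMonoidHom →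
      LRF ((TA HNNExtension.of.range HNNExtension.t k).map
        (MulAut.conj HNNExtension.t⁻¹).toMonoidHom) n x) ∧
    (∀ x ∈ TA (HNNExtension.of.range : Subgroup (HNNExtension G A B φ)) HNNExtension.t (k + 1),
      x ∉ TA HNNExtension.of.range HNNExtension.t k →
      LRF (TA HNNExtension.of.range HNNExtension.t k) n x) := by
  have tr : ∀ S : Subgroup G, (∀ a, a ∉ S → LRF S n a) →
      ∀ a ∈ (HNNExtension.of.range : Subgroup (HNNExtension G A B φ)),
      a ∉ S.map HNNExtension.of → LRF (S.map HNNExtension.of) n a := by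
    rintro S hS _ ⟨a, rfl⟩ ha
    exact (hS a (fun h => ha ⟨a, h, rfl⟩)).map _ (of_injective φ)
  have hle : ∀ S : Subgroup G, S.map HNNExtension.of ≤
      (HNNExtension.of.range : Subgroup (HNNExtension G A B φ)) := by
    rintro S _ ⟨a, _, rfl⟩
    exact ⟨a, rfl⟩
  constructor
  · refine (tower_aux (P := A.map HNNExtension.of) (N := B.map HNNExtension.of) hn (hle _) (hle _)
      (map_conj_inv_t φ) ?_ (tr _ hA) (tr _ hB) k).2.2
    have := britton φ 1
    simpa using this
  · apply tower_second
    refine (tower_aux (P := B.map HNNExtension.of) (N := A.map HNNExtension.of) hn (hle _) (hle _)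
      (map_conj_t φ) ?_ (tr _ hB) (tr _ hA) k).2.2
    have := britton φ (-1)
    simpa using this

end britton

theorem AkSub_eq_TA {C A : Type} [Group C] [Group A] (iP iN : C →* A)
    (hiP : Function.Injective iP) (hiN : Function.Injective iN) (k : ℕ) :
    AkSub iP iN hiP hiN (k : ℤ) = TA HNNExtension.of.range HNNExtension.t k := by
  rw [AkSub, if_neg (by omega), TA_eq_closure]
  congr 1
  ext x
  constructor
  · rintro ⟨a, i, hi, hik, rfl⟩
    lift i to ℕ using hi
    exact ⟨_, ⟨a, rfl⟩, i, by omega, by simp⟩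
  · rintro ⟨_, ⟨a, rfl⟩, i, hi, rfl⟩
    exact ⟨a, i, by omega, by omega, by simp⟩

end RFProof

/-- If `(A, i_P(C))` and `(A, i_N(C))` are `n`-RF, then for every `k ≥ 1` the pairs
`(A_{k-1}, t⁻¹ A_{k-2} t)` and `(A_{k-1}, A_{k-2})` inside `A ∗_C` are `n`-RF. -/
theorem stmt12 {C A : Type} [Group C] [Group A] (iP iN : C →* A)
    (hiP : Function.Injective iP) (hiN : Function.Injective iN)
    (n : ℕ∞) (hn : 2 ≤ n)
    (hP : ∀ a : A, a ∉ iP.range → IsRF iP.range n a)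
    (hN : ∀ a : A, a ∉ iN.range → IsRF iN.range n a) :
    ∀ k : ℤ, 1 ≤ k →
      (∀ g, g ∈ AkSub iP iN hiP hiN (k - 1) → g ∉ AkSubConj iP iN hiP hiN (k - 2) →
        IsRF (AkSubConj iP iN hiP hiN (k - 2)) n g) ∧
      (∀ g, g ∈ AkSub iP iN hiP hiN (k - 1) → g ∉ AkSub iP iN hiP hiN (k - 2) →
        IsRF (AkSub iP iN hiP hiN (k - 2)) n g) := by
  intro k hk
  have hP' : ∀ a : A, a ∉ iP.range → RFProof.LRF iP.range n a :=
    fun a ha => RFProof.lrf_of_isRF (hP a ha)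
  have hN' : ∀ a : A, a ∉ iN.range → RFProof.LRF iN.range n a :=
    fun a ha => RFProof.lrf_of_isRF (hN a ha)
  obtain ⟨j, rfl⟩ : ∃ j : ℕ, k = j + 1 := ⟨(k - 1).toNat, by omega⟩
  have e1 : ((j : ℤ) + 1 - 1) = (j : ℤ) := by omega
  rw [e1]
  cases j with
  | zero =>
    have e2 : (((0 : ℕ) : ℤ) + 1 - 2) = -1 := by norm_num
    have e3 : AkSub iP iN hiP hiN (-1) = Subgroup.map HNNExtension.of iN.range := by
      rw [AkSub, if_pos rfl]
    have e4 : AkSubConj iP iN hiP hiN (-1) = Subgroup.map HNNExtension.of iP.range := by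
      rw [AkSubConj, e3]
      exact RFProof.map_conj_inv_t _
    rw [e2, e3, e4, RFProof.AkSub_eq_TA]
    constructor
    · rintro _ ⟨a, rfl⟩ ha
      exact RFProof.isRF_of_lrf
        ((hP' a (fun h => ha ⟨a, h, rfl⟩)).map _ (HNNExtension.of_injective _))
    · rintro _ ⟨a, rfl⟩ ha
      exact RFProof.isRF_of_lrf
        ((hN' a (fun h => ha ⟨a, h, rfl⟩)).map _ (HNNExtension.of_injective _))
  | succ j =>
    have e2 : (((j + 1 : ℕ) : ℤ) + 1 - 2) = (j : ℤ) := by push_cast; ring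
    rw [e2, AkSubConj, RFProof.AkSub_eq_TA, RFProof.AkSub_eq_TA]
    obtain ⟨h1, h2⟩ := RFProof.hnn_tower (hnnφ iP iN hiP hiN) hn hP' hN' j
    exact ⟨fun g hg hg' => RFProof.isRF_of_lrf (h1 g hg hg'),
      fun g hg hg' => RFProof.isRF_of_lrf (h2 g hg hg')⟩
end

section
/- Let H = A∗_C be the HNN extension associated to injections i_P, i_N : C → A, let p : H → ℤ send t to 1 and A to 0, and for k ≥ 0 let A_k ≤ H be the subgroup generated by {t^{−i} a t^{i} : a ∈ A, 0 ≤ i ≤ k}, with A_{−1} = i_N(C). Then for every w ∈ H with p(w) = 1, either w is conjugate in H to a·t for some a ∈ A, or there exist k ≥ 1, m ≥ 1, elements a_1,…,a_m ∈ A_{k−1} \ t^{−1}A_{k−2}t, elements b_1,…,b_m ∈ A_{k−1} \ A_{k−2}, and x ∈ A_{k−1}, such that w is conjugate in H to a_1 t⁻¹ b_1 t a_2 t⁻¹ b_2 t ⋯ a_m t⁻¹ b_m t x t. -/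
section Helpers

variable {G : Type} [Group G]

/-- The word `a₁ t⁻¹ b₁ t ⋯ a_m t⁻¹ b_m t` attached to a list of pairs. -/
def klWord (t : G) (L : List (G × G)) : G :=
  (L.map fun p => p.1 * t⁻¹ * p.2 * t).prod

lemma klWord_nil (t : G) : klWord t [] = 1 := rfl

lemma klWord_cons (t : G) (p : G × G) (L : List (G × G)) :
    klWord t (p :: L) = p.1 * t⁻¹ * p.2 * t * klWord t L := by
  simp [klWord]

lemma klWord_append (t : G) (L M : List (G × G)) :
    klWord t (L ++ M) = klWord t L * klWord t M := by
  simp [klWord]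

/-- Shortening argument. -/
lemma kl_reduce (t w : G) (S T : Subgroup G) (hTS : T ≤ S)
    (hconj : ∀ c ∈ T, t⁻¹ * c * t ∈ S) (n : ℕ) :
    ∀ (L : List (G × G)), L.length = n → (∀ p ∈ L, p.1 ∈ S ∧ p.2 ∈ S) → ∀ x ∈ S,
      IsConj (klWord t L * x * t) w →
      (∃ y ∈ S, IsConj (y * t) w) ∨
      ∃ L' : List (G × G), 1 ≤ L'.length ∧
        (∀ p ∈ L', (p.1 ∈ S ∧ ¬ ∃ c ∈ T, p.1 = t⁻¹ * c * t) ∧ (p.2 ∈ S ∧ p.2 ∉ T)) ∧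
        ∃ y ∈ S, IsConj (klWord t L' * y * t) w := by
  induction n using Nat.strong_induction_on with
  | _ n ih =>
  intro L hn hL x hx hw
  by_cases hgood : ∀ p ∈ L, (¬ ∃ c ∈ T, p.1 = t⁻¹ * c * t) ∧ p.2 ∉ T
  · rcases Nat.eq_zero_or_pos L.length with h0 | h0
    · left
      rw [List.length_eq_zero_iff] at h0
      subst h0
      exact ⟨x, hx, by simpa [klWord] using hw⟩
    · right
      exact ⟨L, h0, fun p hp => ⟨⟨(hL p hp).1, (hgood p hp).1⟩, (hL p hp).2, (hgood p hp).2⟩,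
        x, hx, hw⟩
  · push Not at hgood
    obtain ⟨⟨a, b⟩, hp, hbad⟩ := hgood
    obtain ⟨L1, L2, rfl⟩ := List.append_of_mem hp
    have haS : a ∈ S := (hL _ hp).1
    have hbS : b ∈ S := (hL _ hp).2
    have hL1 : ∀ p ∈ L1, p.1 ∈ S ∧ p.2 ∈ S := fun p h => hL p (by simp [h])
    have hL2 : ∀ p ∈ L2, p.1 ∈ S ∧ p.2 ∈ S := fun p h => hL p (by simp [h])
    simp only [List.length_append, List.length_cons] at hn
    by_cases hb : b ∈ T
    · have hbS' := hconj b hb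
      -- merge to the right
      rcases L2 with _ | ⟨⟨a', b'⟩, L3⟩
      · refine ih L1.length (by simp at hn; omega) L1 rfl hL1
          (a * (t⁻¹ * b * t) * x) (S.mul_mem (S.mul_mem haS hbS') hx) ?_
        convert hw using 1
        rw [klWord_append, klWord_cons, klWord_nil]
        group
      · have h' := hL2 (a', b') (by simp)
        refine ih (L1.length + (L3.length + 1)) (by simp at hn; omega)
          (L1 ++ (a * (t⁻¹ * b * t) * a', b') :: L3) (by simp) ?_ x hx ?_
        · intro p hp
          rw [List.mem_append, List.mem_cons] at hp
          rcases hp with h | rfl | h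
          · exact hL1 p h
          · exact ⟨S.mul_mem (S.mul_mem haS hbS') h'.1, h'.2⟩
          · exact hL2 p (by simp [h])
        · convert hw using 1
          rw [klWord_append, klWord_append, klWord_cons, klWord_cons, klWord_cons]
          group
    · have ha : ∃ c ∈ T, a = t⁻¹ * c * t := by
        by_contra hcon
        refine hb (hbad ?_)
        intro c hc h
        exact hcon ⟨c, hc, h⟩
      obtain ⟨c, hc, rfl⟩ := ha
      -- merge to the left
      rcases List.eq_nil_or_concat L1 with rfl | ⟨L3, ⟨a', b'⟩, rfl⟩
      · refine ih L2.length (by simp at hn; omega) L2 rfl hL2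
          (x * (c * b)) (S.mul_mem hx (S.mul_mem (hTS hc) hbS)) ?_
        refine IsConj.trans ?_ hw
        rw [isConj_iff]
        refine ⟨t⁻¹ * (c * b) * t, ?_⟩
        rw [List.nil_append, klWord_cons]
        group
      · have h' := hL1 (a', b') (by simp)
        refine ih (L3.length + (L2.length + 1)) (by simp at hn; omega)
          (L3 ++ (a', b' * c * b) :: L2) (by simp) ?_ x hx ?_
        · intro p hp
          rw [List.mem_append, List.mem_cons] at hp
          rcases hp with h | rfl | h
          · exact hL1 p (by simp [h])
          · exact ⟨h'.1, S.mul_mem (S.mul_mem h'.2 (hTS hc)) hbS⟩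
          · exact hL2 p h
        · convert hw using 1
          rw [List.concat_eq_append]
          simp only [klWord_append, klWord_cons, klWord_nil]
          group

/-- Elements of the subgroup generated by `S` and `t⁻¹ S t` are alternating words. -/
lemma kl_exists_word (t : G) (S : Subgroup G) (X : Set G)
    (hX : ∀ g ∈ X, g ∈ S ∨ ∃ b ∈ S, g = t⁻¹ * b * t) (g : G) (hg : g ∈ Subgroup.closure X) :
    ∃ L : List (G × G), (∀ p ∈ L, p.1 ∈ S ∧ p.2 ∈ S) ∧ ∃ x ∈ S, g = klWord t L * x := by
  have key : ∀ s, (s ∈ S ∨ ∃ b ∈ S, s = t⁻¹ * b * t) → ∀ g,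
      (∃ L : List (G × G), (∀ p ∈ L, p.1 ∈ S ∧ p.2 ∈ S) ∧ ∃ x ∈ S, g = klWord t L * x) →
      ∃ L : List (G × G), (∀ p ∈ L, p.1 ∈ S ∧ p.2 ∈ S) ∧ ∃ x ∈ S, s * g = klWord t L * x := by
    rintro s hs g ⟨L, hL, x, hx, rfl⟩
    rcases hs with hs | ⟨b, hb, rfl⟩
    · refine ⟨(s, 1) :: L, ?_, x, hx, by rw [klWord_cons]; group⟩
      intro p hp
      rcases List.mem_cons.1 hp with rfl | h
      · exact ⟨hs, S.one_mem⟩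
      · exact hL p h
    · refine ⟨(1, b) :: L, ?_, x, hx, by rw [klWord_cons]; group⟩
      intro p hp
      rcases List.mem_cons.1 hp with rfl | h
      · exact ⟨S.one_mem, hb⟩
      · exact hL p h
  induction hg using Subgroup.closure_induction_left with
  | one => exact ⟨[], by simp, 1, S.one_mem, by simp [klWord]⟩
  | mul_left s hs y hy ih => exact key s (hX s hs) y ih
  | inv_mul_cancel s hs y hy ih =>
    refine key s⁻¹ ?_ y ih
    rcases hX s hs with h | ⟨b, hb, rfl⟩
    · exact Or.inl (S.inv_mem h)
    · exact Or.inr ⟨b⁻¹, S.inv_mem hb, by group⟩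

end Helpers

section HNNHelpers

variable {C A : Type} [Group C] [Group A] (iP iN : C →* A)
  (hiP : Function.Injective iP) (hiN : Function.Injective iN)

local notation "HH" => HNNExtension A (MonoidHom.range iP) (MonoidHom.range iN) (hnnφ iP iN hiP hiN)

lemma kl_t_rel (c : C) : (HNNExtension.t : HH)⁻¹ * HNNExtension.of (iN c) * HNNExtension.t
    = HNNExtension.of (iP c) := by
  have h := HNNExtension.t_mul_of (φ := hnnφ iP iN hiP hiN) ⟨iP c, c, rfl⟩
  have h2 : ((hnnφ iP iN hiP hiN ⟨iP c, c, rfl⟩ : iN.range) : A) = iN c := by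
    have : (⟨iP c, c, rfl⟩ : iP.range) = MonoidHom.ofInjective hiP c := rfl
    rw [this]
    simp only [hnnφ, MulEquiv.trans_apply, MulEquiv.symm_apply_apply]
    rfl
  rw [h2] at h
  rw [mul_assoc, ← h]
  simp

lemma kl_mem_Ak (k : ℕ) (a : A) (i : ℤ) (h0 : 0 ≤ i) (h1 : i ≤ k) :
    (HNNExtension.t ^ (-i) * HNNExtension.of a * HNNExtension.t ^ i : HH)
      ∈ AkSub iP iN hiP hiN k := by
  rw [AkSub, if_neg (by omega)]
  exact Subgroup.subset_closure ⟨a, i, h0, h1, rfl⟩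

lemma kl_of_mem_Ak (k : ℕ) (a : A) : (HNNExtension.of a : HH) ∈ AkSub iP iN hiP hiN k := by
  simpa using kl_mem_Ak iP iN hiP hiN k a 0 le_rfl (by omega)

lemma kl_le (k : ℕ) : AkSub iP iN hiP hiN ((k : ℤ) - 1) ≤ AkSub iP iN hiP hiN k := by
  rcases Nat.eq_zero_or_pos k with rfl | hk
  · rw [AkSub, if_pos (by simp)]
    rintro _ ⟨a, -, rfl⟩
    exact kl_of_mem_Ak iP iN hiP hiN 0 a
  · rw [AkSub, if_neg (by omega), Subgroup.closure_le]
    rintro _ ⟨a, i, h0, h1, rfl⟩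
    exact kl_mem_Ak iP iN hiP hiN k a i h0 (by omega)

lemma kl_conj_le (k : ℕ) : ∀ c ∈ AkSub iP iN hiP hiN ((k : ℤ) - 1),
    (HNNExtension.t : HH)⁻¹ * c * HNNExtension.t ∈ AkSub iP iN hiP hiN k := by
  suffices h : AkSub iP iN hiP hiN ((k : ℤ) - 1) ≤
      (AkSub iP iN hiP hiN k).comap (MulAut.conj (HNNExtension.t : HH)⁻¹).toMonoidHom by
    intro c hc
    simpa using h hc
  rcases Nat.eq_zero_or_pos k with rfl | hk
  · rw [AkSub, if_pos (by simp)]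
    rintro _ ⟨_, ⟨c, rfl⟩, rfl⟩
    have := kl_of_mem_Ak iP iN hiP hiN 0 (iP c)
    rw [← kl_t_rel] at this
    simpa using this
  · rw [AkSub, if_neg (by omega), Subgroup.closure_le]
    rintro _ ⟨a, i, h0, h1, rfl⟩
    have := kl_mem_Ak iP iN hiP hiN k a (i + 1) (by omega) (by omega)
    have e : (HNNExtension.t : HH) ^ (-(i+1)) * HNNExtension.of a * HNNExtension.t ^ (i + 1) =
      HNNExtension.t⁻¹ * (HNNExtension.t ^ (-i) * HNNExtension.of a * HNNExtension.t ^ i)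
        * HNNExtension.t := by group
    rw [e] at this
    simpa using this

lemma kl_mem_conj (k : ℤ) (g : HH) : g ∈ AkSubConj iP iN hiP hiN k ↔
    ∃ c ∈ AkSub iP iN hiP hiN k, g = (HNNExtension.t)⁻¹ * c * HNNExtension.t := by
  rw [AkSubConj, Subgroup.mem_map]
  simp [eq_comm]

/-- `t⁻ⁱ a tⁱ` for `|i| ≤ N`. -/
noncomputable def klB (N : ℕ) : Subgroup HH :=
  Subgroup.closure {x | ∃ a : A, ∃ i : ℤ, -N ≤ i ∧ i ≤ N ∧
      x = HNNExtension.t ^ (-i) * HNNExtension.of a * HNNExtension.t ^ i}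

lemma klB_mono {N M : ℕ} (h : N ≤ M) : klB iP iN hiP hiN N ≤ klB iP iN hiP hiN M := by
  apply Subgroup.closure_mono
  rintro _ ⟨a, i, h0, h1, rfl⟩
  exact ⟨a, i, by omega, by omega, rfl⟩

lemma klB_conj (N : ℕ) (m : ℤ) (M : ℕ) (hM : |m| ≤ M) (g : HH) (hg : g ∈ klB iP iN hiP hiN N) :
    (HNNExtension.t : HH) ^ m * g * HNNExtension.t ^ (-m) ∈ klB iP iN hiP hiN (N + M) := by
  suffices h : klB iP iN hiP hiN N ≤ (klB iP iN hiP hiN (N + M)).comap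
      (MulAut.conj ((HNNExtension.t : HH) ^ m)).toMonoidHom by
    rw [zpow_neg]
    exact h hg
  rw [klB, Subgroup.closure_le]
  rintro _ ⟨a, i, h0, h1, rfl⟩
  rw [abs_le] at hM
  have : (HNNExtension.t : HH) ^ (-(i - m)) * HNNExtension.of a * HNNExtension.t ^ (i - m)
      ∈ klB iP iN hiP hiN (N + M) :=
    Subgroup.subset_closure ⟨a, i - m, by push_cast; omega, by push_cast; omega, rfl⟩
  have e : (HNNExtension.t : HH) ^ (-(i-m)) * HNNExtension.of a * HNNExtension.t ^ (i - m) =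
      HNNExtension.t ^ m * (HNNExtension.t ^ (-i) * HNNExtension.of a * HNNExtension.t ^ i)
        * HNNExtension.t ^ (-m) := by group
  rw [e, zpow_neg _ m] at this
  exact this

lemma klB_to_Ak (N : ℕ) (g : HH) (hg : g ∈ klB iP iN hiP hiN N) :
    (HNNExtension.t : HH) ^ (-(N : ℤ)) * g * HNNExtension.t ^ (N : ℤ)
      ∈ AkSub iP iN hiP hiN ((2 * N : ℕ) : ℤ) := by
  suffices h : klB iP iN hiP hiN N ≤ (AkSub iP iN hiP hiN ((2 * N : ℕ) : ℤ)).comap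
      (MulAut.conj ((HNNExtension.t : HH) ^ (-(N : ℤ)))).toMonoidHom by
    have e2 : (HNNExtension.t : HH) ^ (N : ℤ) = (HNNExtension.t ^ (-(N : ℤ)))⁻¹ := by simp
    rw [e2]
    exact h hg
  rw [klB, Subgroup.closure_le]
  rintro _ ⟨a, i, h0, h1, rfl⟩
  have := kl_mem_Ak iP iN hiP hiN (2 * N) a (i + N) (by omega) (by push_cast; omega)
  have e : (HNNExtension.t : HH) ^ (-(i+N)) * HNNExtension.of a * HNNExtension.t ^ (i + N) =
      HNNExtension.t ^ (-(N : ℤ)) * (HNNExtension.t ^ (-i) * HNNExtension.of a *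
        HNNExtension.t ^ i) * HNNExtension.t ^ (N : ℤ) := by group
  have e2 : (HNNExtension.t : HH) ^ (N : ℤ) = (HNNExtension.t ^ (-(N : ℤ)))⁻¹ := by simp
  rw [e, e2] at this
  exact this

lemma klB_proj (N : ℕ) (g : HH) (hg : g ∈ klB iP iN hiP hiN N) :
    hnnProj iP iN hiP hiN g = 1 := by
  suffices h : klB iP iN hiP hiN N ≤ (hnnProj iP iN hiP hiN).ker from h hg
  rw [klB, Subgroup.closure_le]
  rintro _ ⟨a, i, h0, h1, rfl⟩
  simp [hnnProj]

lemma kl_decomp (h : HH) : ∃ N : ℕ, ∃ g ∈ klB iP iN hiP hiN N, ∃ n : ℤ,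
    h = g * HNNExtension.t ^ n := by
  induction h using HNNExtension.induction_on with
  | of a => exact ⟨0, HNNExtension.of a, Subgroup.subset_closure ⟨a, 0, by simp⟩, 0, by simp⟩
  | t => exact ⟨0, 1, Subgroup.one_mem _, 1, by simp⟩
  | mul x y hx hy =>
    obtain ⟨N, g, hg, n, rfl⟩ := hx
    obtain ⟨M, g', hg', m, rfl⟩ := hy
    have h2 := klB_conj iP iN hiP hiN M n n.natAbs (by simp) g' hg'
    refine ⟨N + (M + n.natAbs), _, Subgroup.mul_mem _
      (klB_mono iP iN hiP hiN (by omega) hg) (klB_mono iP iN hiP hiN (by omega) h2), n + m, ?_⟩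
    group
  | inv x hx =>
    obtain ⟨N, g, hg, n, rfl⟩ := hx
    have h2 := klB_conj iP iN hiP hiN N (-n) n.natAbs (by simp) _ (Subgroup.inv_mem _ hg)
    refine ⟨_, _, h2, -n, ?_⟩
    group

end HNNHelpers

/-- Klyachko's trick: any `w ∈ A ∗_C` with `p w = 1` is conjugate either to `a·t` for some
`a ∈ A`, or to a word `a₁ t⁻¹ b₁ t ⋯ a_m t⁻¹ b_m t x t` with `aᵢ ∈ A_{k-1} \ t⁻¹A_{k-2}t`,
`bᵢ ∈ A_{k-1} \ A_{k-2}` and `x ∈ A_{k-1}`, for some `k ≥ 1`, `m ≥ 1`. -/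
theorem stmt13 {C A : Type} [Group C] [Group A] (iP iN : C →* A)
    (hiP : Function.Injective iP) (hiN : Function.Injective iN)
    (w : HNNExtension A iP.range iN.range (hnnφ iP iN hiP hiN))
    (hpw : hnnProj iP iN hiP hiN w = Multiplicative.ofAdd 1) :
    (∃ a : A, IsConj (HNNExtension.of a * HNNExtension.t) w) ∨
    ∃ k : ℤ, 1 ≤ k ∧ ∃ m : ℕ, 1 ≤ m ∧
      ∃ a b : Fin m → HNNExtension A iP.range iN.range (hnnφ iP iN hiP hiN),
        ∃ x : HNNExtension A iP.range iN.range (hnnφ iP iN hiP hiN),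
          (∀ i, a i ∈ AkSub iP iN hiP hiN (k - 1) ∧ a i ∉ AkSubConj iP iN hiP hiN (k - 2)) ∧
          (∀ i, b i ∈ AkSub iP iN hiP hiN (k - 1) ∧ b i ∉ AkSub iP iN hiP hiN (k - 2)) ∧
          x ∈ AkSub iP iN hiP hiN (k - 1) ∧
          IsConj
            ((List.ofFn fun i : Fin m =>
                a i * (HNNExtension.t)⁻¹ * b i * HNNExtension.t).prod * x * HNNExtension.t)
            w := by
  obtain ⟨N, g, hg, n, rfl⟩ := kl_decomp iP iN hiP hiN w
  have hn : n = 1 := by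
    rw [map_mul, klB_proj iP iN hiP hiN N g hg, map_zpow] at hpw
    have h1 : hnnProj iP iN hiP hiN HNNExtension.t = Multiplicative.ofAdd 1 := by
      simp [hnnProj]
    rw [h1, one_mul, ← ofAdd_zsmul] at hpw
    simpa using hpw
  subst hn
  generalize hw : g * HNNExtension.t ^ (1 : ℤ) = w
  have start : ∃ g' ∈ AkSub iP iN hiP hiN ((2 * N : ℕ) : ℤ),
      IsConj (g' * HNNExtension.t) w := by
    refine ⟨_, klB_to_Ak iP iN hiP hiN N g hg, ?_⟩
    rw [isConj_iff]
    refine ⟨HNNExtension.t ^ (N : ℤ), ?_⟩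
    rw [← hw]
    group
  clear hpw hw hg
  generalize 2 * N = k at start
  induction k with
  | zero =>
    left
    obtain ⟨g', hg', hc⟩ := start
    have h : AkSub iP iN hiP hiN ((0 : ℕ) : ℤ) ≤ HNNExtension.of.range := by
      rw [AkSub, if_neg (by simp), Subgroup.closure_le]
      rintro _ ⟨a, i, h0, h1, rfl⟩
      have : i = 0 := by push_cast at h1; omega
      subst this
      exact ⟨a, by simp⟩
    obtain ⟨a, rfl⟩ := h hg'
    exact ⟨a, hc⟩
  | succ k ih =>
    obtain ⟨g', hg', hc⟩ := start
    rw [AkSub, if_neg (by omega)] at hg'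
    obtain ⟨L, hL, x, hx, rfl⟩ := kl_exists_word HNNExtension.t (AkSub iP iN hiP hiN k) _ (by
      rintro _ ⟨a, i, h0, h1, rfl⟩
      by_cases hi : i ≤ k
      · exact Or.inl (kl_mem_Ak iP iN hiP hiN k a i h0 hi)
      · refine Or.inr ⟨_, kl_mem_Ak iP iN hiP hiN k a (i - 1) (by omega)
          (by push_cast at h1; omega), ?_⟩
        group) g' hg'
    rcases kl_reduce HNNExtension.t w (AkSub iP iN hiP hiN k)
      (AkSub iP iN hiP hiN ((k : ℤ) - 1)) (kl_le iP iN hiP hiN k)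
      (kl_conj_le iP iN hiP hiN k) L.length L rfl hL x hx hc with h | ⟨L', h1, h2, y, hy, hyc⟩
    · exact ih h
    · right
      have e1 : (k : ℤ) + 1 - 1 = k := by ring
      have e2 : (k : ℤ) + 1 - 2 = k - 1 := by ring
      refine ⟨k + 1, by omega, L'.length, h1, fun i => (L'.get i).1, fun i => (L'.get i).2, y, ?_⟩
      rw [e1, e2]
      refine ⟨fun i => ?_, fun i => ?_, hy, ?_⟩
      · rw [kl_mem_conj]
        exact (h2 _ (List.get_mem L' i)).1
      · exact (h2 _ (List.get_mem L' i)).2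
      · convert hyc using 3
        rw [klWord]
        congr 1
        conv_rhs => rw [← List.ofFn_get L', List.map_ofFn]
        rfl
end

section
/- Let n ≥ 2 be an integer and let c_uu, c_vv, c_uv, c_vu be real numbers with c_uu ≥ 1/n, c_vv ≥ 1/n, and c_uv + c_vu ≥ 1/n. Consider closed walks on the two-element vertex set {u, v}, i.e. cyclic sequences v_0, v_1, …, v_{L−1}, v_L = v_0 (L ≥ 1) of elements of {u,v}, with total cost Σ_{i=0}^{L−1} c_{v_i v_{i+1}}. Then every closed walk that visits u at least n times, and likewise every closed walk that visits v at least n times, has total cost at least 1. -/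
/-- Potential-function lower bound for the cost of a walk prefix. -/
theorem walk_aux (e : ℝ) (he : 0 ≤ e) (c : Bool → Bool → ℝ) (b : Bool)
    (h1 : e ≤ c b b) (h2 : e ≤ c (!b) (!b)) (h3 : e ≤ c b (!b) + c (!b) b)
    (v : ℕ → Bool) (m : ℕ) :
    (((Finset.range m).filter (fun i => v i = b)).card : ℝ) * e
      + (if v m = b then 0 else c b (!b) - e) - (if v 0 = b then 0 else c b (!b) - e)
      ≤ ∑ i ∈ Finset.range m, c (v i) (v (i + 1)) := by
  induction m with
  | zero => simp
  | succ k ih =>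
    rw [Finset.sum_range_succ, Finset.range_add_one, Finset.filter_insert]
    have key : (if v k = b then e else 0) + (if v (k + 1) = b then 0 else c b (!b) - e)
        - (if v k = b then 0 else c b (!b) - e) ≤ c (v k) (v (k + 1)) := by
      generalize v k = x
      generalize v (k + 1) = y
      cases b <;> cases x <;> cases y <;> simp at * <;> linarith
    by_cases h : v k = b
    · rw [if_pos h, Finset.card_insert_of_notMem (by simp)]
      simp only [h, if_true] at key ih ⊢
      push_cast
      linarith
    · rw [if_neg h]
      simp only [h, if_false] at key ih ⊢
      linarith

/-- On the two-element vertex set `{u, v}` (here `u = true`, `v = false`), given costs with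
`c u u ≥ 1/n`, `c v v ≥ 1/n` and `c u v + c v u ≥ 1/n`, every closed walk visiting `u` at
least `n` times — and likewise every closed walk visiting `v` at least `n` times — has total
cost at least `1`. -/
theorem stmt14 (n : ℕ) (hn : 2 ≤ n) (c : Bool → Bool → ℝ)
    (huu : 1 / (n : ℝ) ≤ c true true) (hvv : 1 / (n : ℝ) ≤ c false false)
    (huv : 1 / (n : ℝ) ≤ c true false + c false true)
    (L : ℕ) (hL : 1 ≤ L) (v : ℕ → Bool) (hclosed : v L = v 0)
    (hvisits : n ≤ ((Finset.range L).filter (fun i => v i = true)).card ∨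
               n ≤ ((Finset.range L).filter (fun i => v i = false)).card) :
    1 ≤ ∑ i ∈ Finset.range L, c (v i) (v (i + 1)) := by
  have hn0 : (0 : ℝ) < n := by exact_mod_cast (by omega : 0 < n)
  have he : (0 : ℝ) ≤ 1 / (n : ℝ) := by positivity
  have fin : ∀ b : Bool, n ≤ ((Finset.range L).filter (fun i => v i = b)).card →
      1 / (n : ℝ) ≤ c b b → 1 / (n : ℝ) ≤ c (!b) (!b) →
      1 / (n : ℝ) ≤ c b (!b) + c (!b) b →
      1 ≤ ∑ i ∈ Finset.range L, c (v i) (v (i + 1)) := by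
    intro b hb h1 h2 h3
    have h := walk_aux (1 / (n : ℝ)) he c b h1 h2 h3 v L
    rw [hclosed] at h
    have hb' : (n : ℝ) ≤ (((Finset.range L).filter (fun i => v i = b)).card : ℝ) := by
      exact_mod_cast hb
    have h4 := mul_le_mul_of_nonneg_right hb' he
    have h5 : (n : ℝ) * (1 / (n : ℝ)) = 1 := by field_simp
    linarith
  rcases hvisits with h | h
  · exact fin true h huu hvv huv
  · exact fin false h hvv huu (by simpa [add_comm] using huv)
end

section
/- Fix an integer m ≥ 1 and n with 2 ≤ n ≤ ∞, and let Γ and the cost function c be as in the context. Let ρ be a directed path in Γ from vertex 1 to vertex −1 all of whose vertices are a-vertices, such that ρ does not traverse the edge (−1, 1). Then the cost of ρ is at least 1 − 1/n. Moreover, if ρ visits any vertex other than 1 and −1, then the cost of ρ is at least 2(1 − 1/n). -/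
/-- The vertex set `V = {i ∈ ℤ : 1 ≤ |i| ≤ 2m+1}`. -/
def memV (m i : ℤ) : Prop := 1 ≤ |i| ∧ |i| ≤ 2 * m + 1

/-- `i` is an `a`-vertex: `|i|` odd and `|i| ≤ 2m - 1`. -/
def isA (m i : ℤ) : Prop := Odd |i| ∧ |i| ≤ 2 * m - 1

/-- `i` is a `b`-vertex: `|i|` even. -/
def isB (i : ℤ) : Prop := Even i

/-- The start-side of a vertex: `true` = `P`, `false` = `N`. -/
def startSide (m i : ℤ) : Bool :=
  if i = 2 * m + 1 then true
  else if i = -(2 * m + 1) then false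
  else if i % 2 = 0 then false else true

/-- The end-side of a vertex: `true` = `P`, `false` = `N`. -/
def endSide (m i : ℤ) : Bool :=
  if i = 2 * m + 1 then false
  else if i = -(2 * m + 1) then true
  else if i % 2 = 0 then false else true

/-- `(u, v)` is a directed edge of `Γ`: both are vertices and the end-side of `u`
equals the start-side of `v`. -/
def isEdge (m u v : ℤ) : Prop := memV m u ∧ memV m v ∧ endSide m u = startSide m v

/-- The real number `1/n` for `n : ℕ∞`, with the convention `1/∞ = 0`. -/
noncomputable def invE (n : ℕ∞) : ℝ := ((n.toNat : ℝ))⁻¹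

/-- The cost function `c` on ordered pairs of vertices:
for `1 ≤ i, j ≤ 2m+1`, `c(i,j) = 1 - 1/n` if `i < j`, `1/n` if `j ≤ i < 2m+1`, `0` if
`i = 2m+1`; `c(i,-j) = 0` if `i = 2m+1` or `j = 2m+1` or `i = j = 2m`, else `1 - 1/n`;
`c(-i,j) = 1` if `i = j = 2m+1`, `2/n - 1` if `i = j = 1`, else `1/n`;
`c(-i,-j) = 1 - 1/n` if `i > j`, `1/n` if `i ≤ j < 2m+1`, `0` if `j = 2m+1`. -/
noncomputable def cost (m : ℤ) (n : ℕ∞) (u v : ℤ) : ℝ :=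
  if 0 < u then
    if 0 < v then
      if u = 2 * m + 1 then 0
      else if u < v then 1 - invE n
      else invE n
    else
      if u = 2 * m + 1 ∨ v = -(2 * m + 1) ∨ (u = 2 * m ∧ v = -(2 * m)) then 0
      else 1 - invE n
  else
    if 0 < v then
      if u = -(2 * m + 1) ∧ v = 2 * m + 1 then 1
      else if u = -1 ∧ v = 1 then 2 * invE n - 1
      else invE n
    else
      if v = -(2 * m + 1) then 0
      else if u < v then 1 - invE n
      else invE n

theorem invE_bounds (n : ℕ∞) (hn : 2 ≤ n) : 0 ≤ invE n ∧ invE n ≤ 1 := by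
  unfold invE
  exact ⟨by positivity, Nat.cast_inv_le_one _⟩

/-- Position of an `a`-vertex in the order `1 < 3 < ... < 2m-1 < -(2m-1) < ... < -1`. -/
def keyA (m i : ℤ) : ℤ := if 0 < i then i else 4 * m + i

theorem cost_A (m : ℤ) (n : ℕ∞) (hn : 2 ≤ n) (u v : ℤ) (hu : isA m u) (hv : isA m v)
    (h : ¬(u = -1 ∧ v = 1)) :
    0 ≤ cost m n u v ∧ (keyA m u < keyA m v → 1 - invE n ≤ cost m n u v) := by
  obtain ⟨h0, h1⟩ := invE_bounds n hn
  obtain ⟨-, hu2⟩ := hu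
  obtain ⟨-, hv2⟩ := hv
  rw [abs_le] at hu2 hv2
  have hsub : 0 ≤ 1 - invE n := by linarith
  unfold cost keyA
  split_ifs <;> first
    | (exfalso; omega)
    | exact ⟨hsub, fun _ => le_refl _⟩
    | exact ⟨h0, fun hk => by exfalso; omega⟩

theorem seg_A (m : ℤ) (n : ℕ∞) (v : ℕ → ℤ) (a b : ℕ) (hab : a ≤ b)
    (hc : ∀ i, a ≤ i → i < b → 0 ≤ cost m n (v i) (v (i + 1)) ∧
      (keyA m (v i) < keyA m (v (i + 1)) → 1 - invE n ≤ cost m n (v i) (v (i + 1))))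
    (hk : keyA m (v a) < keyA m (v b)) :
    1 - invE n ≤ ∑ i ∈ Finset.Ico a b, cost m n (v i) (v (i + 1)) := by
  have hex : ∃ i, a ≤ i ∧ i < b ∧ keyA m (v i) < keyA m (v (i + 1)) := by
    by_contra hcon
    push Not at hcon
    have : ∀ k, a ≤ k → k ≤ b → keyA m (v k) ≤ keyA m (v a) := by
      intro k hak
      induction k, hak using Nat.le_induction with
      | base => intro _; exact le_refl _
      | succ k hk ih => intro hkb; exact (hcon k hk (by omega)).trans (ih (by omega))
    exact absurd (this b hab le_rfl) (not_le.mpr hk)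
  obtain ⟨i, h1, h2, h3⟩ := hex
  refine ((hc i h1 h2).2 h3).trans ?_
  exact Finset.single_le_sum (f := fun i => cost m n (v i) (v (i + 1)))
    (fun j hj => (hc j (Finset.mem_Ico.mp hj).1 (Finset.mem_Ico.mp hj).2).1)
    (Finset.mem_Ico.mpr ⟨h1, h2⟩)

/-- Any directed path in `Γ` from vertex `1` to vertex `-1` all of whose vertices are
`a`-vertices and which does not traverse the edge `(-1, 1)` has cost at least `1 - 1/n`;
moreover if it visits any vertex other than `1` and `-1`, its cost is at least `2(1 - 1/n)`. -/
theorem stmt16 (m : ℤ) (hm : 1 ≤ m) (n : ℕ∞) (hn : 2 ≤ n)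
    (L : ℕ) (v : ℕ → ℤ)
    (hstart : v 0 = 1) (hend : v L = -1)
    (hedge : ∀ i < L, isEdge m (v i) (v (i + 1)))
    (hA : ∀ i ≤ L, isA m (v i))
    (hno : ∀ i < L, ¬(v i = -1 ∧ v (i + 1) = 1)) :
    1 - invE n ≤ ∑ i ∈ Finset.range L, cost m n (v i) (v (i + 1)) ∧
    ((∃ i ≤ L, v i ≠ 1 ∧ v i ≠ -1) →
      2 * (1 - invE n) ≤ ∑ i ∈ Finset.range L, cost m n (v i) (v (i + 1))) := by
  have hc : ∀ i, i < L → 0 ≤ cost m n (v i) (v (i + 1)) ∧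
      (keyA m (v i) < keyA m (v (i + 1)) → 1 - invE n ≤ cost m n (v i) (v (i + 1))) :=
    fun i hi => cost_A m n hn _ _ (hA i hi.le) (hA (i + 1) hi) (hno i hi)
  rw [Finset.range_eq_Ico]
  constructor
  · refine seg_A m n v 0 L (Nat.zero_le _) (fun i _ hi => hc i hi) ?_
    rw [hstart, hend]
    unfold keyA
    norm_num
    omega
  · rintro ⟨k, hkL, hk1, hk2⟩
    obtain ⟨hodd, hle⟩ := hA k hkL
    have h0 : v k ≠ 0 := by
      intro h
      rw [h] at hodd
      simp at hodd
    rw [abs_le] at hle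
    rw [← Finset.sum_Ico_consecutive _ (Nat.zero_le k) hkL]
    have s1 := seg_A m n v 0 k (Nat.zero_le _) (fun i _ hi => hc i (by omega)) (by
      rw [hstart]; unfold keyA; split_ifs <;> omega)
    have s2 := seg_A m n v k L hkL (fun i _ hi => hc i hi) (by
      rw [hend]; unfold keyA; split_ifs <;> omega)
    linarith
end

section
/- Fix an integer m ≥ 1 and n with 2 ≤ n ≤ ∞, and let Γ and the cost function c be as in the context. Then every closed directed walk in Γ that visits both the vertex 2m+1 and the vertex −(2m+1) has total cost at least 1. -/
/-- A potential: `1/n` on positive `a`-vertices, `1 - 1/n` on negative ones, `0` elsewhere. -/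
noncomputable def pot (m : ℤ) (x : ℝ) (u : ℤ) : ℝ :=
  if u = 2 * m + 1 ∨ u = -(2 * m + 1) ∨ u % 2 = 0 then 0
  else if 0 < u then x else 1 - x

lemma invE_nonneg (n : ℕ∞) : 0 ≤ invE n := by unfold invE; positivity

lemma invE_le (n : ℕ∞) (hn : 2 ≤ n) : invE n ≤ 1 / 2 := by
  unfold invE
  induction n using ENat.recTopCoe with
  | top => norm_num
  | coe k =>
    have hk : 2 ≤ k := by exact_mod_cast hn
    have hk' : (2 : ℝ) ≤ k := by exact_mod_cast hk
    rw [ENat.toNat_natCast, one_div]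
    exact inv_anti₀ (by norm_num) hk'

set_option maxHeartbeats 4000000 in
lemma edge_bound (m : ℤ) (hm : 1 ≤ m) (n : ℕ∞) (hn : 2 ≤ n) (u v : ℤ) (h : isEdge m u v) :
    (if v = 2 * m + 1 then (1 : ℝ) else 0) + (pot m (invE n) v - pot m (invE n) u)
      ≤ cost m n u v := by
  have h0 := invE_nonneg n
  have h1 := invE_le n hn
  obtain ⟨⟨hu1, hu2⟩, ⟨hv1, hv2⟩, hs⟩ := h
  rw [abs_le] at hu2 hv2
  rw [le_abs] at hu1 hv1
  unfold endSide startSide at hs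
  unfold pot cost
  generalize invE n = x at *
  split_ifs at hs <;> first | (exfalso; simp at hs; done) | skip
  all_goals split_ifs <;> first | linarith | (exfalso; omega)

/-- Every closed directed walk in `Γ` visiting both `2m+1` and `-(2m+1)` has total cost
at least `1`. -/
theorem stmt19 (m : ℤ) (hm : 1 ≤ m) (n : ℕ∞) (hn : 2 ≤ n)
    (L : ℕ) (hL : 1 ≤ L) (v : ℕ → ℤ) (hclosed : v L = v 0)
    (hedge : ∀ i < L, isEdge m (v i) (v (i + 1)))
    (hpos : ∃ i < L, v i = 2 * m + 1) (hneg : ∃ i < L, v i = -(2 * m + 1)) :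
    1 ≤ ∑ i ∈ Finset.range L, cost m n (v i) (v (i + 1)) := by
  have hsum := Finset.sum_le_sum (fun i hi =>
    edge_bound m hm n hn (v i) (v (i + 1)) (hedge i (Finset.mem_range.1 hi)))
  rw [Finset.sum_add_distrib, Finset.sum_range_sub (fun i => pot m (invE n) (v i)),
    hclosed, sub_self, add_zero] at hsum
  refine le_trans ?_ hsum
  have key : ∃ j < L, v (j + 1) = 2 * m + 1 := by
    obtain ⟨i, hi, hv⟩ := hpos
    rcases i with _ | i
    · exact ⟨L - 1, by omega, by rw [Nat.sub_add_cancel hL, hclosed, hv]⟩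
    · exact ⟨i, by omega, hv⟩
  obtain ⟨j, hj, hv⟩ := key
  have := Finset.single_le_sum
    (f := fun i => if v (i + 1) = 2 * m + 1 then (1 : ℝ) else 0)
    (fun i _ => by split_ifs <;> norm_num) (Finset.mem_range.2 hj)
  simpa [hv] using this
end
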